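/- arXiv:0911.0948 — 3 statements merged into one kernel-verified Lean document; each statement's English description precedes it below -/
import Mathlib

section
/- Let n ≥ 3, let Ω ⊂ ℝ^n be a bounded open connected set containing the origin, and set D := sup_{x ∈ Ω} |x|. Let a > 0 and set C_n(a) := (n-2)^{-2(n-1)/n} S_n if a ≥ 1/(n-2) and C_n(a) := a^{2(n-1)/n} S_n if 0 < a < 1/(n-2). Then C_n(a) is the best constant, independently of Ω: for every C > C_n(a) there exists a nonzero u ∈ C_c^∞(Ω) such that ∫_Ω |∇u|² dx − ((n-2)/2)² ∫_Ω u²/|x|² dx < C · ( ∫_Ω X_1(a, |x|/D)^{2(n-1)/(n-2)} |u|^{2n/(n-2)} dx )^{(n-2)/n}. -/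
open MeasureTheory Real

/-- The best Sobolev constant `S_n = π n (n-2) (Γ(n/2)/Γ(n))^(2/n)`. -/
noncomputable def sobolevConst (n : ℕ) : ℝ :=
  Real.pi * n * ((n : ℝ) - 2) * (Real.Gamma ((n : ℝ) / 2) / Real.Gamma (n : ℝ)) ^ (2 / (n : ℝ))

/-- `X_1(a,s) = (a - ln s)⁻¹`. -/
noncomputable def X1 (a s : ℝ) : ℝ := (a - Real.log s)⁻¹

lemma integrableOn_beta {u v : ℝ} (hu : 0 < u) (hv : 0 < v) :
    IntegrableOn (fun x : ℝ => x ^ (u - 1) * (1 - x) ^ (v - 1)) (Set.Ioo 0 1) := by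
  have h := Complex.betaIntegral_convergent (u := u) (v := v) (by simpa) (by simpa)
  rw [intervalIntegrable_iff_integrableOn_Ioo_of_le zero_le_one] at h
  refine IntegrableOn.congr_fun h.re ?_ measurableSet_Ioo
  intro x hx
  have h1 : (x : ℂ) ^ ((u : ℂ) - 1) = ((x ^ (u - 1) : ℝ) : ℂ) := by
    rw [Complex.ofReal_cpow hx.1.le]; push_cast; rfl
  have h2 : (1 - (x : ℂ)) ^ ((v : ℂ) - 1) = (((1 - x) ^ (v - 1) : ℝ) : ℂ) := by
    rw [Complex.ofReal_cpow (by linarith [hx.2])]; push_cast; rfl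
  simp only [h1, h2, ← Complex.ofReal_mul]
  simp

lemma integral_beta {u v : ℝ} (hu : 0 < u) (hv : 0 < v) :
    ∫ x in Set.Ioo (0 : ℝ) 1, x ^ (u - 1) * (1 - x) ^ (v - 1) =
      Gamma u * Gamma v / Gamma (u + v) := by
  have h := ProbabilityTheory.beta_eq_betaIntegralReal u v hu hv
  rw [ProbabilityTheory.beta, Complex.betaIntegral,
    intervalIntegral.integral_of_le zero_le_one, integral_Ioc_eq_integral_Ioo] at h
  rw [h]
  have : ∫ x in Set.Ioo (0 : ℝ) 1, (x : ℂ) ^ ((u : ℂ) - 1) * (1 - (x : ℂ)) ^ ((v : ℂ) - 1) =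
      ∫ x in Set.Ioo (0 : ℝ) 1, ((x ^ (u - 1) * (1 - x) ^ (v - 1) : ℝ) : ℂ) := by
    refine setIntegral_congr_fun measurableSet_Ioo fun x hx => ?_
    have h1 : (x : ℂ) ^ ((u : ℂ) - 1) = ((x ^ (u - 1) : ℝ) : ℂ) := by
      rw [Complex.ofReal_cpow hx.1.le]; push_cast; rfl
    have h2 : (1 - (x : ℂ)) ^ ((v : ℂ) - 1) = (((1 - x) ^ (v - 1) : ℝ) : ℂ) := by
      rw [Complex.ofReal_cpow (by linarith [hx.2])]; push_cast; rfl
    simp only [h1, h2, ← Complex.ofReal_mul]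
  rw [this, integral_complex_ofReal, Complex.ofReal_re]

lemma image_rpow_div_one_sub {m : ℝ} (hm : 0 < m) :
    (fun z : ℝ => (z / (1 - z)) ^ m) '' Set.Ioo 0 1 = Set.Ioi 0 := by
  ext t
  constructor
  · rintro ⟨z, hz, rfl⟩
    have : 0 < 1 - z := by linarith [hz.2]
    exact rpow_pos_of_pos (div_pos hz.1 this) m
  · intro ht
    have ht : 0 < t := ht
    have hp : 0 < t ^ (1 / m) := rpow_pos_of_pos ht _
    refine ⟨t ^ (1 / m) / (1 + t ^ (1 / m)), ⟨by positivity, ?_⟩, ?_⟩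
    · rw [div_lt_one (by positivity)]; linarith
    · have : t ^ (1 / m) / (1 + t ^ (1 / m)) / (1 - t ^ (1 / m) / (1 + t ^ (1 / m))) = t ^ (1 / m) := by
        field_simp; ring
      simp only [this]
      rw [← rpow_mul ht.le, one_div_mul_cancel hm.ne', rpow_one]

lemma hasDerivAt_rpow_div_one_sub {m z : ℝ} (hz : z ∈ Set.Ioo (0 : ℝ) 1) :
    HasDerivAt (fun z : ℝ => (z / (1 - z)) ^ m) (m * z ^ (m - 1) * (1 - z) ^ (-m - 1)) z := by
  have h1 : 0 < 1 - z := by linarith [hz.2]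
  have hd : HasDerivAt (fun z : ℝ => z / (1 - z)) (1 / (1 - z) ^ 2) z := by
    have := (hasDerivAt_id z).div ((hasDerivAt_id z).const_sub 1) h1.ne'
    refine this.congr_deriv ?_
    simp only [id]
    ring
  convert hd.rpow_const (p := m) (Or.inl (div_pos hz.1 h1).ne') using 1
  rw [div_rpow hz.1.le h1.le, rpow_sub_one h1.ne' (-m), rpow_neg h1.le, rpow_sub_one h1.ne' m]
  field_simp

lemma injOn_rpow_div_one_sub {m : ℝ} (hm : 0 < m) :
    Set.InjOn (fun z : ℝ => (z / (1 - z)) ^ m) (Set.Ioo 0 1) := by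
  intro x hx y hy h
  have h1 : 0 < 1 - x := by linarith [hx.2]
  have h2 : 0 < 1 - y := by linarith [hy.2]
  have := (rpow_left_inj (div_pos hx.1 h1).le (div_pos hy.1 h2).le hm.ne').1 h
  rw [div_eq_div_iff h1.ne' h2.ne'] at this
  linarith

lemma beta_substitution {m : ℝ} (hm : 0 < m) (c d : ℝ) {z : ℝ} (hz : z ∈ Set.Ioo (0 : ℝ) 1) :
    |m * z ^ (m - 1) * (1 - z) ^ (-m - 1)| •
      ((((z / (1 - z)) ^ m) ^ (1 / m)) ^ c * (1 + ((z / (1 - z)) ^ m) ^ (1 / m)) ^ (-d)) =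
      m * (z ^ (m + c - 1) * (1 - z) ^ (d - m - c - 1)) := by
  have h1 : 0 < 1 - z := by linarith [hz.2]
  have h0 := hz.1
  have hq : 0 < z / (1 - z) := div_pos h0 h1
  have : 1 + z / (1 - z) = (1 - z)⁻¹ := by field_simp; ring
  rw [← rpow_mul hq.le, mul_one_div_cancel hm.ne', rpow_one, this, abs_of_pos (by positivity),
    div_rpow h0.le h1.le, inv_rpow h1.le, rpow_neg h1.le, inv_inv, smul_eq_mul,
    show m + c - 1 = (m - 1) + c by ring, show d - m - c - 1 = (-m - 1) + d + (-c) by ring,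
    rpow_add h0, rpow_add h1, rpow_add h1, rpow_neg h1.le c]
  field_simp

lemma integrableOn_rpow_mul_one_add_rpow {m c d : ℝ} (hm : 0 < m) (hc : 0 < m + c)
    (hd : 0 < d - m - c) :
    IntegrableOn (fun t : ℝ => (t ^ (1 / m)) ^ c * (1 + t ^ (1 / m)) ^ (-d)) (Set.Ioi 0) := by
  rw [← image_rpow_div_one_sub hm, integrableOn_image_iff_integrableOn_abs_deriv_smul
    measurableSet_Ioo (fun z hz => (hasDerivAt_rpow_div_one_sub hz).hasDerivWithinAt)
    (injOn_rpow_div_one_sub hm)]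
  exact IntegrableOn.congr_fun ((integrableOn_beta hc hd).const_mul m)
    (fun z hz => (beta_substitution hm c d hz).symm) measurableSet_Ioo

lemma integral_rpow_mul_one_add_rpow {m c d : ℝ} (hm : 0 < m) (hc : 0 < m + c)
    (hd : 0 < d - m - c) :
    ∫ t in Set.Ioi (0 : ℝ), (t ^ (1 / m)) ^ c * (1 + t ^ (1 / m)) ^ (-d) =
      m * (Gamma (m + c) * Gamma (d - m - c) / Gamma d) := by
  rw [← image_rpow_div_one_sub hm, integral_image_eq_integral_abs_deriv_smul
    measurableSet_Ioo (fun z hz => (hasDerivAt_rpow_div_one_sub hz).hasDerivWithinAt)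
    (injOn_rpow_div_one_sub hm),
    setIntegral_congr_fun measurableSet_Ioo (fun z hz => beta_substitution hm c d hz),
    integral_const_mul, integral_beta hc hd]
  congr 3
  ring

lemma contDiff_indicator_Ioi {h : ℝ → ℝ} {r₁ r₂ : ℝ} (hr : 0 < r₁)
    (hh : ContDiffOn ℝ (⊤ : ℕ∞) h (Set.Ioi 0)) (hs : ∀ x > 0, h x ≠ 0 → x ∈ Set.Icc r₁ r₂) :
    ContDiff ℝ (⊤ : ℕ∞) ((Set.Ioi 0).indicator h) := by
  refine contDiff_iff_contDiffAt.2 fun x => ?_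
  rcases lt_or_ge 0 x with hx | hx
  · refine (hh.contDiffAt (Ioi_mem_nhds hx)).congr_of_eventuallyEq ?_
    filter_upwards [Ioi_mem_nhds hx] with y hy
    exact Set.indicator_of_mem hy h
  · refine (contDiffAt_const (c := (0 : ℝ))).congr_of_eventuallyEq ?_
    filter_upwards [Iio_mem_nhds (lt_of_le_of_lt hx hr)] with y hy
    refine Set.indicator_apply_eq_zero.2 fun hy0 => ?_
    by_contra hne
    exact absurd (hs y hy0 hne).1 (not_le.2 hy)

lemma support_indicator_Ioi {h : ℝ → ℝ} {r₁ r₂ : ℝ}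
    (hs : ∀ x > 0, h x ≠ 0 → x ∈ Set.Icc r₁ r₂) (x : ℝ) (hx : (Set.Ioi 0).indicator h x ≠ 0) :
    x ∈ Set.Icc r₁ r₂ := by
  have h0 : x ∈ Set.Ioi (0 : ℝ) := Set.mem_of_indicator_ne_zero hx
  rw [Set.indicator_of_mem h0] at hx
  exact hs x h0 hx

lemma deriv_indicator_Ioi (h : ℝ → ℝ) {x : ℝ} (hx : 0 < x) :
    deriv ((Set.Ioi 0).indicator h) x = deriv h x := by
  refine Filter.EventuallyEq.deriv_eq ?_
  filter_upwards [Ioi_mem_nhds hx] with y hy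
  exact Set.indicator_of_mem hy h

lemma contDiffOn_one_add_rpow (q e : ℝ) :
    ContDiffOn ℝ (⊤ : ℕ∞) (fun t : ℝ => (1 + t ^ q) ^ e) (Set.Ioi 0) := by
  intro t ht
  have ht : 0 < t := ht
  have h1 : 0 < 1 + t ^ q := by have := rpow_pos_of_pos ht q; linarith
  exact ((contDiffAt_const.add (contDiffAt_rpow_const_of_ne ht.ne')).rpow_const_of_ne
    h1.ne').contDiffWithinAt

lemma hasDerivAt_bliss {m t : ℝ} (hm : 0 < m) (ht : 0 < t) :
    HasDerivAt (fun t : ℝ => t * (1 + t ^ (1 / m)) ^ (-m)) ((1 + t ^ (1 / m)) ^ (-m - 1)) t := by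
  have h1 : 0 < 1 + t ^ (1 / m) := by have := rpow_pos_of_pos ht (1 / m); linarith
  have h := (hasDerivAt_id t).mul
    (((hasDerivAt_rpow_const (p := 1 / m) (Or.inl ht.ne')).const_add 1).rpow_const
      (p := -m) (Or.inl h1.ne'))
  refine h.congr_deriv ?_
  rw [rpow_sub_one h1.ne', rpow_sub_one ht.ne']
  simp only [id]
  field_simp
  ring

/-- Truncations of the Bliss extremal `t (1 + t^{1/m})^{-m}` on a logarithmic scale. -/
lemma exists_test_of_bliss {m K : ℝ} (hm : 0 < m)
    (hK : (∫ t in Set.Ioi (0 : ℝ), (1 + t ^ (1 / m)) ^ (-(2 * m + 2))) <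
      K * (∫ t in Set.Ioi (0 : ℝ), t ^ (1 / m) * (1 + t ^ (1 / m)) ^ (-(2 * m + 2))) ^
        (m / (m + 1)))
    (hB : 0 < ∫ t in Set.Ioi (0 : ℝ), t ^ (1 / m) * (1 + t ^ (1 / m)) ^ (-(2 * m + 2))) :
    ∃ W : ℝ → ℝ, ContDiff ℝ (⊤ : ℕ∞) W ∧
      (∃ t₁ t₂ : ℝ, 0 < t₁ ∧ ∀ t, W t ≠ 0 → t ∈ Set.Icc t₁ t₂) ∧
      (∫ t in Set.Ioi (0 : ℝ), deriv W t ^ 2) <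
        K * (∫ t in Set.Ioi (0 : ℝ), t ^ (-((2 * m + 1) / m)) * |W t| ^ (2 * (m + 1) / m)) ^
          (m / (m + 1)) := by
  let χ : ContDiffBump (0 : ℝ) := ⟨1, 2, one_pos, one_lt_two⟩
  have hχ : ContDiff ℝ (⊤ : ℕ∞) χ := χ.contDiff
  obtain ⟨M, hM⟩ : ∃ M, ∀ x, ‖deriv χ x‖ ≤ M :=
    (hχ.continuous_deriv (by simp)).bounded_above_of_compact_support χ.hasCompactSupport.deriv
  have hM0 : 0 ≤ M := (norm_nonneg _).trans (hM 0)
  let h : ℕ → ℝ → ℝ := fun k t => t * (1 + t ^ (1 / m)) ^ (-m) * χ (log t / (k + 1))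
  have hk0 : ∀ k : ℕ, (0 : ℝ) < k + 1 := fun k => by positivity
  have hsm : ∀ k, ContDiffOn ℝ (⊤ : ℕ∞) (h k) (Set.Ioi 0) := fun k => by
    refine (contDiffOn_id.mul (contDiffOn_one_add_rpow _ _)).mul ?_
    refine hχ.comp_contDiffOn (ContDiffOn.div_const ?_ _)
    exact contDiffOn_log.mono fun x (hx : 0 < x) => hx.ne'
  have hsupp : ∀ k : ℕ, ∀ t > 0, h k t ≠ 0 →
      t ∈ Set.Icc (exp (-(2 * (k + 1)))) (exp (2 * (k + 1))) := fun k t ht hne => by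
    have h1 : log t / (k + 1) ∈ Function.support χ := right_ne_zero_of_mul hne
    rw [χ.support_eq, Metric.mem_ball, dist_zero_right, norm_div, norm_eq_abs, norm_eq_abs,
      abs_of_pos (hk0 k), div_lt_iff₀ (hk0 k), abs_lt] at h1
    exact ⟨(le_log_iff_exp_le ht).1 h1.1.le, (log_le_iff_le_exp ht).1 h1.2.le⟩
  let W : ℕ → ℝ → ℝ := fun k => (Set.Ioi 0).indicator (h k)
  have hW : ∀ k, ContDiff ℝ (⊤ : ℕ∞) (W k) := fun k =>
    contDiff_indicator_Ioi (exp_pos _) (hsm k) (hsupp k)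
  have hWt : ∀ k, ∀ t > 0, W k t = h k t := fun k t ht => Set.indicator_of_mem ht _
  have hd : ∀ k, ∀ t > 0, deriv (W k) t = (1 + t ^ (1 / m)) ^ (-m - 1) * χ (log t / (k + 1)) +
      (1 + t ^ (1 / m)) ^ (-m) * (deriv χ (log t / (k + 1)) / (k + 1)) := fun k t ht => by
    rw [deriv_indicator_Ioi _ ht]
    have h2 := (hχ.differentiable (by simp) (log t / (k + 1))).hasDerivAt.comp t
      ((hasDerivAt_log ht.ne').div_const ((k : ℝ) + 1))
    have h3 : HasDerivAt (h k) _ t := (hasDerivAt_bliss hm ht).mul h2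
    rw [h3.deriv]
    have := hk0 k
    field_simp
  have hlim : ∀ t : ℝ, Filter.Tendsto (fun k : ℕ => log t / ((k : ℝ) + 1)) Filter.atTop (nhds 0) :=
    fun t => by
      have := (tendsto_one_div_add_atTop_nhds_zero_nat (𝕜 := ℝ)).const_mul (log t)
      simpa [div_eq_mul_inv] using this
  have hχ0 : χ 0 = 1 := χ.one_of_mem_closedBall (by simp [χ])
  have hχlim : ∀ t : ℝ, Filter.Tendsto (fun k : ℕ => χ (log t / ((k : ℝ) + 1))) Filter.atTop
      (nhds 1) := fun t => by
    have := (hχ.continuous.tendsto 0).comp (hlim t)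
    rwa [hχ0] at this
  have hdlim : ∀ t : ℝ, Filter.Tendsto
      (fun k : ℕ => deriv χ (log t / ((k : ℝ) + 1)) / ((k : ℝ) + 1)) Filter.atTop (nhds 0) :=
    fun t => by
      refine squeeze_zero_norm (a := fun k : ℕ => M * (1 / ((k : ℝ) + 1))) (fun k => ?_) ?_
      · rw [norm_div, norm_of_nonneg (hk0 k).le, mul_one_div]
        exact div_le_div_of_nonneg_right (hM _) (hk0 k).le
      · simpa using (tendsto_one_div_add_atTop_nhds_zero_nat (𝕜 := ℝ)).const_mul M
  have hA : Filter.Tendsto (fun k => ∫ t in Set.Ioi (0 : ℝ), deriv (W k) t ^ 2) Filter.atTop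
      (nhds (∫ t in Set.Ioi (0 : ℝ), (1 + t ^ (1 / m)) ^ (-(2 * m + 2)))) := by
    refine tendsto_integral_of_dominated_convergence
      (fun t => (1 + M) ^ 2 * ((t ^ (1 / m)) ^ (0 : ℝ) * (1 + t ^ (1 / m)) ^ (-(2 * m))))
      (fun k => (((hW k).continuous_deriv (by simp)).pow 2).aestronglyMeasurable)
      ((integrableOn_rpow_mul_one_add_rpow hm (by linarith) (by linarith)).const_mul _)
      (fun k => ?_) ?_
    · filter_upwards [ae_restrict_mem measurableSet_Ioi] with t ht
      have ht : 0 < t := ht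
      have hq := rpow_pos_of_pos ht (1 / m)
      have h1 : 0 < 1 + t ^ (1 / m) := by linarith
      rw [hd k t ht, norm_pow, rpow_zero, one_mul,
        show -(2 * m) = (-m) * (2 : ℕ) by push_cast; ring, rpow_mul_natCast h1.le, ← mul_pow]
      refine pow_le_pow_left₀ (norm_nonneg _) ?_ 2
      have e1 : ‖(1 + t ^ (1 / m)) ^ (-m - 1) * χ (log t / (k + 1))‖ ≤ (1 + t ^ (1 / m)) ^ (-m) := by
        rw [norm_mul, norm_of_nonneg (rpow_pos_of_pos h1 _).le, norm_of_nonneg χ.nonneg]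
        refine (mul_le_of_le_one_right (rpow_pos_of_pos h1 _).le χ.le_one).trans ?_
        exact rpow_le_rpow_of_exponent_le (by linarith) (by linarith)
      have e2 : ‖(1 + t ^ (1 / m)) ^ (-m) * (deriv χ (log t / (k + 1)) / (k + 1))‖ ≤
          (1 + t ^ (1 / m)) ^ (-m) * M := by
        rw [norm_mul, norm_of_nonneg (rpow_pos_of_pos h1 _).le, norm_div,
          norm_of_nonneg (hk0 k).le]
        refine mul_le_mul_of_nonneg_left ?_ (rpow_pos_of_pos h1 _).le
        refine (div_le_self (norm_nonneg _) ?_).trans (hM _)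
        have : (0 : ℝ) ≤ k := k.cast_nonneg
        linarith
      calc _ ≤ _ := norm_add_le_of_le e1 e2
        _ = _ := by ring
    · filter_upwards [ae_restrict_mem measurableSet_Ioi] with t ht
      have ht : 0 < t := ht
      have hq := rpow_pos_of_pos ht (1 / m)
      have h1 : 0 < 1 + t ^ (1 / m) := by linarith
      simp_rw [hd _ t ht]
      have := ((((hχlim t).const_mul ((1 + t ^ (1 / m)) ^ (-m - 1))).add
        ((hdlim t).const_mul ((1 + t ^ (1 / m)) ^ (-m)))).pow 2)
      rwa [mul_one, mul_zero, add_zero, ← rpow_mul_natCast h1.le,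
        show (-m - 1) * ((2 : ℕ) : ℝ) = -(2 * m + 2) by push_cast; ring] at this
  have hpw : ∀ t : ℝ, 0 < t → t ^ (-((2 * m + 1) / m)) * (t * (1 + t ^ (1 / m)) ^ (-m)) ^ (2 * (m + 1) / m)
      = t ^ (1 / m) * (1 + t ^ (1 / m)) ^ (-(2 * m + 2)) := fun t ht => by
    have hq := rpow_pos_of_pos ht (1 / m)
    have h1 : 0 < 1 + t ^ (1 / m) := by linarith
    rw [mul_rpow ht.le (rpow_pos_of_pos h1 _).le, ← mul_assoc, ← rpow_add ht, ← rpow_mul h1.le]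
    congr 2
    · field_simp; ring
    · field_simp
  have hp0 : 0 < 2 * (m + 1) / m := by positivity
  have hBl : Filter.Tendsto (fun k => ∫ t in Set.Ioi (0 : ℝ), t ^ (-((2 * m + 1) / m)) *
      |W k t| ^ (2 * (m + 1) / m)) Filter.atTop
      (nhds (∫ t in Set.Ioi (0 : ℝ), t ^ (1 / m) * (1 + t ^ (1 / m)) ^ (-(2 * m + 2)))) := by
    refine tendsto_integral_of_dominated_convergence
      (fun t => (t ^ (1 / m)) ^ (1 : ℝ) * (1 + t ^ (1 / m)) ^ (-(2 * m + 2)))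
      (fun k => ?_)
      (integrableOn_rpow_mul_one_add_rpow hm (by linarith) (by linarith))
      (fun k => ?_) ?_
    · have := (hW k).continuous.measurable
      exact Measurable.aestronglyMeasurable (by fun_prop)
    · filter_upwards [ae_restrict_mem measurableSet_Ioi] with t ht
      have ht : 0 < t := ht
      have hq := rpow_pos_of_pos ht (1 / m)
      have h1 : 0 < 1 + t ^ (1 / m) := by linarith
      rw [rpow_one, ← hpw t ht, norm_of_nonneg (by positivity), hWt k t ht]
      refine mul_le_mul_of_nonneg_left (rpow_le_rpow (abs_nonneg _) ?_ hp0.le)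
        (rpow_pos_of_pos ht _).le
      rw [abs_mul, abs_of_nonneg (χ.nonneg), abs_of_pos (by positivity)]
      exact mul_le_of_le_one_right (by positivity) χ.le_one
    · filter_upwards [ae_restrict_mem measurableSet_Ioi] with t ht
      have ht : 0 < t := ht
      have hq := rpow_pos_of_pos ht (1 / m)
      have h1 : 0 < 1 + t ^ (1 / m) := by linarith
      have h2 : 0 < t * (1 + t ^ (1 / m)) ^ (-m) := by positivity
      simp_rw [hWt _ t ht, ← hpw t ht]
      refine Filter.Tendsto.const_mul _ (Filter.Tendsto.rpow_const ?_ (Or.inr hp0.le))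
      have := ((hχlim t).const_mul (t * (1 + t ^ (1 / m)) ^ (-m))).abs
      rwa [mul_one, abs_of_pos h2] at this
  have hev := hA.eventually_lt ((hBl.rpow_const (p := m / (m + 1)) (Or.inl hB.ne')).const_mul K) hK
  obtain ⟨k, hk⟩ := hev.exists
  exact ⟨W k, hW k, ⟨_, _, exp_pos _, support_indicator_Ioi (hsupp k)⟩, hk⟩

lemma tsupport_radial_subset {E : Type*} [NormedAddCommGroup E] {g : ℝ → ℝ}
    {r₁ r₂ : ℝ} (hs : ∀ ρ, g ρ ≠ 0 → ρ ∈ Set.Icc r₁ r₂) (x₀ : E) :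
    tsupport (fun x => g ‖x - x₀‖) ⊆ {x | ‖x - x₀‖ ∈ Set.Icc r₁ r₂} := by
  refine closure_minimal (fun x hx => hs _ hx) ?_
  exact isClosed_Icc.preimage (by fun_prop : Continuous fun x : E => ‖x - x₀‖)

section Radial

variable {E : Type*} [NormedAddCommGroup E] [InnerProductSpace ℝ E]

lemma contDiff_radial {g : ℝ → ℝ} {r₁ r₂ : ℝ} (hg : ContDiff ℝ (⊤ : ℕ∞) g) (hr : 0 < r₁)
    (hs : ∀ ρ, g ρ ≠ 0 → ρ ∈ Set.Icc r₁ r₂) (x₀ : E) :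
    ContDiff ℝ (⊤ : ℕ∞) (fun x => g ‖x - x₀‖) := by
  refine contDiff_iff_contDiffAt.2 fun x => ?_
  rcases eq_or_ne x x₀ with rfl | hx
  · refine (contDiffAt_const (c := (0 : ℝ))).congr_of_eventuallyEq ?_
    filter_upwards [Metric.ball_mem_nhds x hr] with y hy
    by_contra hne
    rw [Metric.mem_ball, dist_eq_norm] at hy
    exact absurd (hs _ hne).1 (not_le.2 hy)
  · exact hg.contDiffAt.comp x
      ((contDiffAt_id.sub contDiffAt_const).norm ℝ (sub_ne_zero.2 hx))

lemma hasCompactSupport_radial [FiniteDimensional ℝ E] {g : ℝ → ℝ} {r₁ r₂ : ℝ}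
    (hs : ∀ ρ, g ρ ≠ 0 → ρ ∈ Set.Icc r₁ r₂) (x₀ : E) :
    HasCompactSupport (fun x => g ‖x - x₀‖) := by
  have : ProperSpace E := FiniteDimensional.proper ℝ E
  refine (isCompact_closedBall x₀ r₂).of_isClosed_subset (isClosed_tsupport _) fun x hx => ?_
  rw [Metric.mem_closedBall, dist_eq_norm]
  exact (tsupport_radial_subset hs x₀ hx).2

lemma norm_gradient_radial [CompleteSpace E] [Nontrivial E] {g : ℝ → ℝ} {r₁ r₂ : ℝ}
    (hg : ContDiff ℝ (⊤ : ℕ∞) g) (hr : 0 < r₁)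
    (hs : ∀ ρ, g ρ ≠ 0 → ρ ∈ Set.Icc r₁ r₂) (x₀ x : E) :
    ‖gradient (fun x => g ‖x - x₀‖) x‖ = |deriv g ‖x - x₀‖| := by
  rw [gradient, LinearIsometryEquiv.norm_map]
  rcases eq_or_ne x x₀ with rfl | hx
  · have h1 : (fun y => g ‖y - x‖) =ᶠ[nhds x] fun _ => 0 := by
      filter_upwards [Metric.ball_mem_nhds x hr] with y hy
      by_contra hne
      rw [Metric.mem_ball, dist_eq_norm] at hy
      exact absurd (hs _ hne).1 (not_le.2 hy)
    have h2 : g =ᶠ[nhds 0] fun _ => 0 := by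
      filter_upwards [Iio_mem_nhds hr] with y hy
      by_contra hne
      exact absurd (hs _ hne).1 (not_le.2 hy)
    rw [h1.fderiv_eq, sub_self, norm_zero, h2.deriv_eq]
    simp
  · have hd : DifferentiableAt ℝ (fun y : E => ‖y‖) (x - x₀) :=
      (contDiffAt_norm ℝ (sub_ne_zero.2 hx)).differentiableAt one_ne_zero
    have h1 := hd.hasFDerivAt.comp x ((hasFDerivAt_id x).sub_const x₀)
    rw [ContinuousLinearMap.comp_id] at h1
    have h2 := (hg.differentiable (by simp) ‖x - x₀‖).hasDerivAt.comp_hasFDerivAt x h1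
    have h3 : HasFDerivAt (fun y => g ‖y - x₀‖) _ x := h2
    rw [h3.fderiv, norm_smul, norm_fderiv_norm hd, mul_one, norm_eq_abs]

end Radial

/-- The surface area of the unit sphere of `ℝⁿ`. -/
noncomputable def sphereArea (n : ℕ) : ℝ :=
  n * volume.real (Metric.ball (0 : EuclideanSpace ℝ (Fin n)) 1)

lemma sphereArea_eq {n : ℕ} (hn : 0 < n) :
    sphereArea n = 2 * π ^ ((n : ℝ) / 2) / Gamma ((n : ℝ) / 2) := by
  have : Nonempty (Fin n) := ⟨⟨0, hn⟩⟩
  have hn' : (0 : ℝ) < n := by exact_mod_cast hn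
  have hG : 0 < Gamma ((n : ℝ) / 2) := Gamma_pos_of_pos (by positivity)
  have hs : √π ^ n = π ^ ((n : ℝ) / 2) := by
    rw [sqrt_eq_rpow, ← rpow_natCast, ← rpow_mul pi_pos.le]
    congr 1; ring
  rw [sphereArea, measureReal_def, EuclideanSpace.volume_ball, Fintype.card_fin,
    Gamma_add_one (by positivity), hs, ENNReal.ofReal_one, one_pow, one_mul,
    ENNReal.toReal_ofReal (by positivity)]
  field_simp

lemma sphereArea_pos {n : ℕ} (hn : 0 < n) : 0 < sphereArea n := by
  have hn' : (0 : ℝ) < n := by exact_mod_cast hn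
  have hG : 0 < Gamma ((n : ℝ) / 2) := Gamma_pos_of_pos (by positivity)
  rw [sphereArea_eq hn]
  positivity

lemma integral_radial {n : ℕ} (hn : 0 < n) (F : ℝ → ℝ) (x₀ : EuclideanSpace ℝ (Fin n)) :
    ∫ x, F ‖x - x₀‖ = sphereArea n * ∫ r in Set.Ioi (0 : ℝ), r ^ (n - 1) * F r := by
  have : Nonempty (Fin n) := ⟨⟨0, hn⟩⟩
  rw [integral_sub_right_eq_self (fun x : EuclideanSpace ℝ (Fin n) => F ‖x‖) x₀,
    integral_fun_norm_addHaar]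
  simp [sphereArea, mul_assoc]

lemma setIntegral_gradient_sq_radial {n : ℕ} (hn : 0 < n) {g : ℝ → ℝ} {r₁ r₂ : ℝ}
    (hg : ContDiff ℝ (⊤ : ℕ∞) g) (hr : 0 < r₁) (hs : ∀ ρ, g ρ ≠ 0 → ρ ∈ Set.Icc r₁ r₂)
    (x₀ : EuclideanSpace ℝ (Fin n)) {Ω : Set (EuclideanSpace ℝ (Fin n))}
    (hΩ : tsupport (fun x => g ‖x - x₀‖) ⊆ Ω) :
    ∫ x in Ω, ‖gradient (fun x => g ‖x - x₀‖) x‖ ^ 2 =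
      sphereArea n * ∫ r in Set.Ioi (0 : ℝ), r ^ (n - 1) * deriv g r ^ 2 := by
  have : Nonempty (Fin n) := ⟨⟨0, hn⟩⟩
  rw [setIntegral_eq_integral_of_forall_compl_eq_zero, ← integral_radial hn _ x₀]
  · refine integral_congr_ae (Filter.Eventually.of_forall fun x => ?_)
    simp only [norm_gradient_radial hg hr hs, sq_abs]
  · intro x hx
    have : fderiv ℝ (fun x => g ‖x - x₀‖) x = 0 := by
      by_contra hne
      exact hx (hΩ (support_fderiv_subset ℝ hne))
    rw [gradient, this]
    simp

/-- A profile that almost attains the sharp constant, in the variable where the problem is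
one-dimensional. -/
lemma exists_profile {n : ℕ} (hn : 3 ≤ n) {C : ℝ}
    (hC : ((n : ℝ) - 2) ^ (-(2 * ((n : ℝ) - 1)) / (n : ℝ)) * sobolevConst n < C) :
    ∃ W : ℝ → ℝ, ContDiff ℝ (⊤ : ℕ∞) W ∧
      (∃ t₁ t₂ : ℝ, 0 < t₁ ∧ ∀ t, W t ≠ 0 → t ∈ Set.Icc t₁ t₂) ∧
      sphereArea n * (∫ t in Set.Ioi (0 : ℝ), deriv W t ^ 2) <
        C * (sphereArea n * ∫ t in Set.Ioi (0 : ℝ),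
          t ^ (-(2 * ((n : ℝ) - 1) / ((n : ℝ) - 2))) * |W t| ^ (2 * (n : ℝ) / ((n : ℝ) - 2))) ^
            (((n : ℝ) - 2) / (n : ℝ)) := by
  have hn3 : (3 : ℝ) ≤ n := by exact_mod_cast hn
  have hω := sphereArea_pos (n := n) (by omega)
  have hωe := sphereArea_eq (n := n) (by omega)
  rw [sobolevConst] at hC
  obtain ⟨m, hm⟩ : ∃ m : ℝ, m = ((n : ℝ) - 2) / 2 := ⟨_, rfl⟩
  have hnm : (n : ℝ) = 2 * m + 2 := by rw [hm]; ring
  rw [hnm] at hωe hC ⊢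
  generalize sphereArea n = ω at hω hωe ⊢
  have hm0 : 0 < m := by rw [hm]; linarith
  have e7 : 2 * m + 2 - 2 = 2 * m := by ring
  have e1 : 2 * (2 * m + 2 - 1) / (2 * m + 2 - 2) = (2 * m + 1) / m := by
    rw [e7]; field_simp; ring
  have e2 : 2 * (2 * m + 2) / (2 * m + 2 - 2) = 2 * (m + 1) / m := by
    rw [e7]; field_simp
  have e3 : (2 * m + 2 - 2) / (2 * m + 2) = m / (m + 1) := by field_simp; ring
  have e4 : -(2 * (2 * m + 2 - 1)) / (2 * m + 2) = -1 - m / (m + 1) := by field_simp; ring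
  have e5 : 2 / (2 * m + 2) = 1 - m / (m + 1) := by field_simp; ring
  have e6 : (2 * m + 2) / 2 = m + 1 := by ring
  rw [e4, e5, e6, e7] at hC
  rw [e6] at hωe
  rw [e1, e2, e3]
  have hG := Gamma_pos_of_pos (show 0 < m + 1 by linarith)
  have hGn := Gamma_pos_of_pos (show 0 < 2 * m + 2 by linarith)
  have hA : (∫ t in Set.Ioi (0 : ℝ), (1 + t ^ (1 / m)) ^ (-(2 * m + 2))) =
      (m + 1) * (Gamma (m + 1) * (Gamma (m + 1) / Gamma (2 * m + 2))) := by
    have := integral_rpow_mul_one_add_rpow (c := 0) (d := 2 * m + 2) hm0 (by linarith)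
      (by linarith)
    simp only [rpow_zero, one_mul, add_zero, sub_zero] at this
    rw [this, show 2 * m + 2 - m = m + 1 + 1 by ring, Gamma_add_one (by linarith : m + 1 ≠ 0),
      Gamma_add_one hm0.ne']
    ring
  have hB : (∫ t in Set.Ioi (0 : ℝ), t ^ (1 / m) * (1 + t ^ (1 / m)) ^ (-(2 * m + 2))) =
      m * (Gamma (m + 1) * (Gamma (m + 1) / Gamma (2 * m + 2))) := by
    have := integral_rpow_mul_one_add_rpow (c := 1) (d := 2 * m + 2) hm0 (by linarith)
      (by linarith)
    simp only [rpow_one] at this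
    rw [this, show 2 * m + 2 - m - 1 = m + 1 by ring]
    ring
  have hQ : 0 < Gamma (m + 1) / Gamma (2 * m + 2) := div_pos hG hGn
  generalize Gamma (m + 1) / Gamma (2 * m + 2) = Q at hA hB hQ hC
  generalize Gamma (m + 1) = G at hA hB hG hωe
  have hωG : ω * G = 2 * π ^ (m + 1) := by rw [hωe]; field_simp
  obtain ⟨e, he⟩ : ∃ e : ℝ, e = m / (m + 1) := ⟨_, rfl⟩
  have hem : (m + 1) * e = m := by rw [he]; field_simp
  rw [← he] at hC ⊢
  have hsharp : ω * ((m + 1) * (G * Q)) = (2 * m) ^ (-1 - e) *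
      (π * (2 * m + 2) * (2 * m) * Q ^ (1 - e)) * (ω * (m * (G * Q))) ^ e := by
    have h2m : 0 < 2 * m := by linarith
    have hπ := pi_pos
    rw [show ω * (m * (G * Q)) = (2 * m) * π ^ (m + 1) * Q by linear_combination (m * Q) * hωG,
      mul_rpow (by positivity) hQ.le, mul_rpow h2m.le (by positivity), ← rpow_mul hπ.le, hem,
      rpow_sub h2m, rpow_sub hQ, rpow_neg h2m.le, rpow_one, rpow_one]
    have : 0 < (2 * m) ^ e := rpow_pos_of_pos h2m _
    have : 0 < Q ^ e := rpow_pos_of_pos hQ _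
    rw [rpow_add_one hπ.ne'] at hωG
    field_simp
    linear_combination hωG
  have hBpos : 0 < m * (G * Q) := by positivity
  obtain ⟨W, hW, hWs, hlt⟩ := exists_test_of_bliss (m := m) (K := C * ω ^ e / ω) hm0
    (by
      rw [hA, hB, ← he, div_mul_eq_mul_div, lt_div_iff₀ hω, mul_assoc C, ← mul_rpow hω.le hBpos.le,
        mul_comm _ ω, hsharp]
      exact mul_lt_mul_of_pos_right hC (rpow_pos_of_pos (by positivity) _))
    (by rw [hB]; exact hBpos)
  refine ⟨W, hW, hWs, ?_⟩
  have hB0 : 0 ≤ ∫ t in Set.Ioi (0 : ℝ), t ^ (-((2 * m + 1) / m)) * |W t| ^ (2 * (m + 1) / m) :=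
    setIntegral_nonneg measurableSet_Ioi fun t ht =>
      mul_nonneg (rpow_nonneg (le_of_lt ht) _) (rpow_nonneg (abs_nonneg _) _)
  rwa [← he, div_mul_eq_mul_div, lt_div_iff₀ hω, mul_assoc C, ← mul_rpow hω.le hB0,
    mul_comm _ ω] at hlt

lemma integral_comp_mul_rpow_neg {N μ : ℝ} (hN : 0 < N) (hμ : 0 < μ) (G : ℝ → ℝ) :
    ∫ r in Set.Ioi (0 : ℝ), r ^ (-N - 1) * G (μ * r ^ (-N)) =
      (N * μ)⁻¹ * ∫ t in Set.Ioi (0 : ℝ), G t := by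
  have h1 := integral_comp_rpow_Ioi (fun y => G (μ * y)) (p := -N) (by linarith)
  have h2 := integral_comp_mul_left_Ioi G 0 hμ
  rw [mul_zero, smul_eq_mul] at h2
  rw [h2, abs_neg, abs_of_pos hN] at h1
  simp only [smul_eq_mul, mul_assoc] at h1
  rw [integral_const_mul] at h1
  rw [mul_inv, mul_assoc, ← h1, inv_mul_cancel_left₀ hN.ne']

lemma integral_comp_sub_log {a D l : ℝ} (hD : 0 < D) (hl : 0 < l) (G : ℝ → ℝ) :
    ∫ r in Set.Ioi (0 : ℝ), r⁻¹ * G ((a - log (r / D)) / l) = l * ∫ s, G s := by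
  have him : (fun s : ℝ => D * exp (a - l * s)) '' Set.univ = Set.Ioi 0 := by
    ext r
    constructor
    · rintro ⟨s, -, rfl⟩
      exact mul_pos hD (exp_pos _)
    · intro hr
      have hr : 0 < r := hr
      refine ⟨(a - log (r / D)) / l, trivial, ?_⟩
      simp only
      rw [mul_div_cancel₀ _ hl.ne', sub_sub_cancel, exp_log (div_pos hr hD),
        mul_div_cancel₀ _ hD.ne']
  have hder : ∀ s ∈ Set.univ, HasDerivWithinAt (fun s : ℝ => D * exp (a - l * s))
      (-(l * (D * exp (a - l * s)))) Set.univ s := fun s _ => by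
    have h := ((((hasDerivAt_id s).const_mul l).const_sub a).exp.const_mul D).hasDerivWithinAt
      (s := Set.univ)
    refine h.congr_deriv ?_
    simp only [id]
    ring
  have hinj : Set.InjOn (fun s : ℝ => D * exp (a - l * s)) Set.univ := fun x _ y _ h => by
    have := exp_injective (mul_left_cancel₀ hD.ne' h)
    exact mul_left_cancel₀ hl.ne' (by linarith)
  rw [← him, integral_image_eq_integral_abs_deriv_smul MeasurableSet.univ hder hinj,
    setIntegral_univ, ← integral_const_mul]
  refine integral_congr_ae (Filter.Eventually.of_forall fun s => ?_)
  have he := exp_pos (a - l * s)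
  simp only [smul_eq_mul]
  rw [abs_neg, abs_of_pos (by positivity), mul_div_cancel_left₀ _ hD.ne', log_exp,
    sub_sub_cancel, mul_div_cancel_left₀ _ hl.ne']
  field_simp

lemma integral_mul_deriv_self {W : ℝ → ℝ} (hW : ContDiff ℝ (⊤ : ℕ∞) W)
    (hc : HasCompactSupport W) : ∫ t, W t * deriv W t = 0 := by
  have hd : ∀ t, HasDerivAt (fun t => W t ^ 2) (2 * (W t * deriv W t)) t := fun t => by
    refine ((hW.differentiable (by simp) t).hasDerivAt.pow 2).congr_deriv ?_
    ring
  have hcont := hW.continuous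
  have hdcont : Continuous (deriv W) := hW.continuous_deriv (by simp)
  have hint : Integrable fun t => W t ^ 2 := by
    refine Continuous.integrable_of_hasCompactSupport (by fun_prop) ?_
    simp only [pow_two]
    exact hc.mul_right
  have hint' : Integrable fun t => 2 * (W t * deriv W t) := by
    refine (Continuous.integrable_of_hasCompactSupport (by fun_prop) ?_).const_mul 2
    exact hc.mul_right
  have := integral_eq_zero_of_hasDerivAt_of_integrable hd hint' hint
  rw [integral_const_mul] at this
  linarith

lemma setIntegral_radial {n : ℕ} (hn : 0 < n) (F : ℝ → ℝ) (x₀ : EuclideanSpace ℝ (Fin n))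
    {Ω : Set (EuclideanSpace ℝ (Fin n))} (hF : ∀ x ∉ Ω, F ‖x - x₀‖ = 0) :
    ∫ x in Ω, F ‖x - x₀‖ = sphereArea n * ∫ r in Set.Ioi (0 : ℝ), r ^ (n - 1) * F r := by
  rw [setIntegral_eq_integral_of_forall_compl_eq_zero hF, integral_radial hn]

/-- Test functions concentrating at the origin. -/
lemma exists_test_origin {n : ℕ} (hn : 3 ≤ n) {a D R C : ℝ} (hD : 0 < D) (hR : 0 < R)
    {Ω : Set (EuclideanSpace ℝ (Fin n))} (hΩ : Metric.ball 0 R ⊆ Ω)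
    (hC : ((n : ℝ) - 2) ^ (-(2 * ((n : ℝ) - 1)) / (n : ℝ)) * sobolevConst n < C) :
    ∃ u : EuclideanSpace ℝ (Fin n) → ℝ, ContDiff ℝ (⊤ : ℕ∞) u ∧ HasCompactSupport u ∧
      tsupport u ⊆ Ω ∧
      (∫ x in Ω, ‖gradient u x‖ ^ 2) - (((n : ℝ) - 2) / 2) ^ 2 *
          (∫ x in Ω, u x ^ 2 / ‖x‖ ^ 2)
        < C *
          (∫ x in Ω,
              (X1 a (‖x‖ / D)) ^ (2 * ((n : ℝ) - 1) / ((n : ℝ) - 2)) *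
                |u x| ^ (2 * (n : ℝ) / ((n : ℝ) - 2)))
            ^ (((n : ℝ) - 2) / (n : ℝ)) := by
  obtain ⟨W, hW, ⟨t₁, t₂, ht₁, hs⟩, hlt⟩ := exists_profile hn hC
  have hn0 : 0 < n := by omega
  have hn3 : (3 : ℝ) ≤ n := by exact_mod_cast hn
  have hn1 : ((n - 1 : ℕ) : ℝ) = n - 1 := by rw [Nat.cast_sub (by omega)]; simp
  have hN : 0 < (n : ℝ) - 2 := by linarith
  obtain ⟨m, hm⟩ : ∃ m : ℝ, m = ((n : ℝ) - 2) / 2 := ⟨_, rfl⟩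
  obtain ⟨β, hβ⟩ : ∃ β : ℝ, β = 2 * ((n : ℝ) - 1) / ((n : ℝ) - 2) := ⟨_, rfl⟩
  obtain ⟨p, hp⟩ : ∃ p : ℝ, p = 2 * (n : ℝ) / ((n : ℝ) - 2) := ⟨_, rfl⟩
  have hp0 : 0 < p := by rw [hp]; positivity
  have hmp : m * p = n := by rw [hm, hp]; field_simp
  rw [← hm, ← hβ, ← hp]
  rw [← hβ, ← hp] at hlt
  obtain ⟨l, hl⟩ := exists_gt (max 0 ((a - log (R / D)) / t₁))
  have hl0 : 0 < l := (le_max_left _ _).trans_lt hl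
  have hlR : D * exp (a - l * t₁) < R := by
    have := (div_lt_iff₀ ht₁).1 ((le_max_right _ _).trans_lt hl)
    rw [← lt_div_iff₀' hD, ← lt_log_iff_exp_lt (div_pos hR hD)]
    linarith
  let φ : ℝ → ℝ := fun r => (a - log (r / D)) / l
  let h : ℝ → ℝ := fun r => r ^ (-m) * W (φ r)
  have hφ : ∀ r, l * φ r = a - log (r / D) := fun r => mul_div_cancel₀ _ hl0.ne'
  have hh : ContDiffOn ℝ (⊤ : ℕ∞) h (Set.Ioi 0) := by
    refine ContDiffOn.mul (fun r hr => ?_) (hW.comp_contDiffOn (fun r hr => ?_))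
    · exact (contDiffAt_rpow_const_of_ne (ne_of_gt hr)).contDiffWithinAt
    · exact ((contDiffAt_const.sub ((contDiffAt_id.div_const D).log
        (div_pos hr hD).ne')).div_const l).contDiffWithinAt
  have hsupp : ∀ r > 0, h r ≠ 0 →
      r ∈ Set.Icc (D * exp (a - l * t₂)) (D * exp (a - l * t₁)) := fun r hr hne => by
    have h1 := hs _ (right_ne_zero_of_mul hne)
    have h2 := mul_le_mul_of_nonneg_left h1.1 hl0.le
    have h3 := mul_le_mul_of_nonneg_left h1.2 hl0.le
    rw [hφ] at h2 h3
    rw [Set.mem_Icc, ← le_div_iff₀' hD, ← div_le_iff₀' hD, ← log_le_iff_le_exp (div_pos hr hD),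
      ← le_log_iff_exp_le (div_pos hr hD)]
    exact ⟨by linarith, by linarith⟩
  let g : ℝ → ℝ := (Set.Ioi 0).indicator h
  have hr₁ : 0 < D * exp (a - l * t₂) := mul_pos hD (exp_pos _)
  have hg : ContDiff ℝ (⊤ : ℕ∞) g := contDiff_indicator_Ioi hr₁ hh hsupp
  have hgs := support_indicator_Ioi hsupp
  have hgr : ∀ r : ℝ, 0 < r → g r = r ^ (-m) * W (φ r) := fun r hr => Set.indicator_of_mem hr h
  have hdg : ∀ r : ℝ, 0 < r →
      deriv g r = -(r ^ (-m - 1)) * (m * W (φ r) + l⁻¹ * deriv W (φ r)) := fun r hr => by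
    rw [deriv_indicator_Ioi h hr]
    have h1 : HasDerivAt φ (-(r⁻¹) / l) r := by
      refine (((((hasDerivAt_id r).div_const D).log (div_pos hr hD).ne').const_sub a).div_const
        l).congr_deriv ?_
      simp only [id]
      field_simp
    have h2 : HasDerivAt h _ r := (hasDerivAt_rpow_const (p := -m) (Or.inl hr.ne')).mul
      ((hW.differentiable (by simp) (φ r)).hasDerivAt.comp r h1)
    rw [h2.deriv, rpow_sub_one hr.ne']
    field_simp
    ring
  have hts : tsupport (fun x : EuclideanSpace ℝ (Fin n) => g ‖x - 0‖) ⊆ Ω := fun x hx => by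
    refine hΩ ?_
    have := (tsupport_radial_subset hgs 0 hx).2
    rw [Metric.mem_ball, dist_eq_norm]
    exact this.trans_lt hlR
  have hoff : ∀ x ∉ Ω, g ‖x - 0‖ = 0 := fun x hx => by
    by_contra hne
    exact hx (hts (subset_tsupport _ hne))
  refine ⟨fun x => g ‖x - 0‖, contDiff_radial hg hr₁ hgs 0, hasCompactSupport_radial hgs 0, hts, ?_⟩
  have hcomp : HasCompactSupport W := HasCompactSupport.of_support_subset_isCompact isCompact_Icc hs
  have hWc := hW.continuous
  have hdWc : Continuous (deriv W) := hW.continuous_deriv (by simp)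
  have i1 : Integrable fun t => W t ^ 2 :=
    (hWc.pow 2).integrable_of_hasCompactSupport (by simp only [pow_two]; exact hcomp.mul_right)
  have i2 : Integrable fun t => W t * deriv W t :=
    (hWc.mul hdWc).integrable_of_hasCompactSupport hcomp.mul_right
  have i3 : Integrable fun t => deriv W t ^ 2 :=
    (hdWc.pow 2).integrable_of_hasCompactSupport
      (by simp only [pow_two]; exact hcomp.deriv.mul_right)
  have hW0 : ∀ t ≤ 0, W t = 0 := fun t ht => by
    by_contra hne
    exact absurd (hs t hne).1 (not_le.2 (ht.trans_lt ht₁))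
  have hdW0 : ∀ t ≤ 0, deriv W t = 0 := fun t ht => by
    have : W =ᶠ[nhds t] fun _ => 0 := by
      filter_upwards [Iio_mem_nhds (ht.trans_lt ht₁)] with s hs'
      by_contra hne
      exact absurd (hs s hne).1 (not_le.2 hs')
    rw [this.deriv_eq, deriv_const]
  have hE : (∫ x in Ω, ‖gradient (fun x => g ‖x - 0‖) x‖ ^ 2) =
      sphereArea n * (l * (m ^ 2 * ∫ t, W t ^ 2) + l⁻¹ * ∫ t in Set.Ioi (0 : ℝ), deriv W t ^ 2) := by
    rw [setIntegral_gradient_sq_radial hn0 hg hr₁ hgs 0 hts,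
      setIntegral_congr_fun (g := fun r => r⁻¹ * (m * W (φ r) + l⁻¹ * deriv W (φ r)) ^ 2)
        measurableSet_Ioi fun r hr => ?_,
      integral_comp_sub_log hD hl0 (fun s => (m * W s + l⁻¹ * deriv W s) ^ 2)]
    · have e : ∀ s, (m * W s + l⁻¹ * deriv W s) ^ 2 =
          m ^ 2 * W s ^ 2 + 2 * m * l⁻¹ * (W s * deriv W s) + l⁻¹ ^ 2 * deriv W s ^ 2 :=
        fun s => by ring
      simp_rw [e]
      have i12 : Integrable fun s => m ^ 2 * W s ^ 2 + 2 * m * l⁻¹ * (W s * deriv W s) :=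
        (i1.const_mul _).add (i2.const_mul _)
      rw [integral_add i12 (i3.const_mul _),
        integral_add (i1.const_mul _) (i2.const_mul _), integral_const_mul, integral_const_mul,
        integral_const_mul, integral_mul_deriv_self hW hcomp,
        setIntegral_eq_integral_of_forall_compl_eq_zero (s := Set.Ioi 0)
          (fun t ht => by rw [hdW0 t (not_lt.1 ht)]; simp)]
      field_simp
      ring
    · have hr : 0 < r := hr
      have e : r ^ (n - 1) * (r ^ (-m - 1)) ^ 2 = r⁻¹ := by
        rw [← rpow_natCast, ← rpow_natCast (r ^ (-m - 1)), ← rpow_mul hr.le, ← rpow_add hr,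
          ← rpow_neg_one, hn1, hm]
        congr 1
        push_cast
        ring
      simp only [hdg r hr]
      rw [← e]
      ring
  have hH : (∫ x in Ω, (g ‖x - 0‖) ^ 2 / ‖x‖ ^ 2) = sphereArea n * (l * ∫ t, W t ^ 2) := by
    have := setIntegral_radial hn0 (fun r => g r ^ 2 / r ^ 2) (0 : EuclideanSpace ℝ (Fin n))
      (Ω := Ω) (fun x hx => by simp only [hoff x hx]; simp)
    rw [setIntegral_congr_fun (s := Set.Ioi 0) (g := fun r => r⁻¹ * W (φ r) ^ 2)
        measurableSet_Ioi fun r hr => ?_,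
      integral_comp_sub_log hD hl0 (fun s => W s ^ 2)] at this
    · rw [← this]
      simp only [sub_zero]
    · have hr : 0 < r := hr
      have e : r ^ (n - 1) * (r ^ (-m)) ^ 2 = r⁻¹ * r ^ 2 := by
        rw [← rpow_natCast, ← rpow_natCast (r ^ (-m)), ← rpow_natCast r 2, ← rpow_mul hr.le,
          ← rpow_add hr, ← rpow_neg_one, ← rpow_add hr, hn1, hm]
        congr 1
        push_cast
        ring
      simp only [hgr r hr]
      field_simp at e ⊢
      linear_combination (W (φ r)) ^ 2 * e
  have hP : (∫ x in Ω, X1 a (‖x‖ / D) ^ β * |g ‖x - 0‖| ^ p) =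
      sphereArea n * (l ^ (1 - β) * ∫ t in Set.Ioi (0 : ℝ), t ^ (-β) * |W t| ^ p) := by
    have hset : ∫ s, ((l * s)⁻¹) ^ β * |W s| ^ p =
        ∫ s in Set.Ioi (0 : ℝ), ((l * s)⁻¹) ^ β * |W s| ^ p :=
      (setIntegral_eq_integral_of_forall_compl_eq_zero
        fun t ht => by rw [hW0 t (not_lt.1 ht)]; simp [zero_rpow hp0.ne']).symm
    have := setIntegral_radial hn0 (fun r => X1 a (r / D) ^ β * |g r| ^ p)
      (0 : EuclideanSpace ℝ (Fin n)) (Ω := Ω)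
      (fun x hx => by simp only [hoff x hx]; simp [zero_rpow hp0.ne'])
    rw [setIntegral_congr_fun (s := Set.Ioi 0)
        (g := fun r => r⁻¹ * (((l * φ r)⁻¹) ^ β * |W (φ r)| ^ p))
        measurableSet_Ioi fun r hr => ?_,
      integral_comp_sub_log hD hl0 (fun s => ((l * s)⁻¹) ^ β * |W s| ^ p),
      hset, setIntegral_congr_fun (s := Set.Ioi 0)
        (g := fun s => l ^ (-β) * (s ^ (-β) * |W s| ^ p))
        measurableSet_Ioi fun s hs' => ?_, integral_const_mul, ← mul_assoc l] at this
    · rw [sub_eq_add_neg, rpow_add hl0, rpow_one, ← this]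
      simp only [sub_zero]
    · have hs0 : 0 < s := hs'
      simp only
      rw [inv_rpow (by positivity), ← rpow_neg (by positivity), mul_rpow hl0.le hs0.le]
      ring
    · have hr : 0 < r := hr
      have e : r ^ (n - 1) * (r ^ (-m)) ^ p = r⁻¹ := by
        rw [← rpow_natCast, ← rpow_mul hr.le, ← rpow_add hr, ← rpow_neg_one, hn1, neg_mul, hmp]
        congr 1
        ring
      simp only [hgr r hr]
      rw [abs_mul, abs_of_pos (rpow_pos_of_pos hr _), mul_rpow (by positivity) (abs_nonneg _), ← e,
        hφ, X1]
      ring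
  have hB0 : 0 ≤ ∫ t in Set.Ioi (0 : ℝ), t ^ (-β) * |W t| ^ p :=
    setIntegral_nonneg measurableSet_Ioi fun t ht =>
      mul_nonneg (rpow_nonneg (le_of_lt ht) _) (rpow_nonneg (abs_nonneg _) _)
  have hω := sphereArea_pos hn0
  rw [hE, hH, hP, mul_left_comm (sphereArea n) (l ^ (1 - β)), mul_rpow (by positivity) (by positivity),
    ← rpow_mul hl0.le,
    show (1 - β) * (((n : ℝ) - 2) / n) = -1 by rw [hβ]; field_simp; ring, rpow_neg_one]
  calc _ = l⁻¹ * (sphereArea n * ∫ t in Set.Ioi (0 : ℝ), deriv W t ^ 2) := by ring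
    _ < l⁻¹ * _ := mul_lt_mul_of_pos_left hlt (inv_pos.2 hl0)
    _ = _ := by ring

/-- Test functions concentrating at a point near which the weight is bounded below. -/
lemma exists_test_near {n : ℕ} (hn : 3 ≤ n) {a b D r C : ℝ} (hb : 0 < b)
    (hr : 0 < r) {Ω : Set (EuclideanSpace ℝ (Fin n))} (hΩo : IsOpen Ω)
    {x₀ : EuclideanSpace ℝ (Fin n)} (hΩ : Metric.ball x₀ r ⊆ Ω)
    (hX : ∀ x ∈ Ω, 0 ≤ X1 a (‖x‖ / D) ∧ X1 a (‖x‖ / D) ≤ a⁻¹)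
    (hXb : ∀ x ∈ Metric.ball x₀ r, b⁻¹ ≤ X1 a (‖x‖ / D))
    (hC : b ^ (2 * ((n : ℝ) - 1) / (n : ℝ)) * sobolevConst n < C) :
    ∃ u : EuclideanSpace ℝ (Fin n) → ℝ, ContDiff ℝ (⊤ : ℕ∞) u ∧ HasCompactSupport u ∧
      tsupport u ⊆ Ω ∧
      (∫ x in Ω, ‖gradient u x‖ ^ 2) - (((n : ℝ) - 2) / 2) ^ 2 *
          (∫ x in Ω, u x ^ 2 / ‖x‖ ^ 2)
        < C *
          (∫ x in Ω,
              (X1 a (‖x‖ / D)) ^ (2 * ((n : ℝ) - 1) / ((n : ℝ) - 2)) *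
                |u x| ^ (2 * (n : ℝ) / ((n : ℝ) - 2)))
            ^ (((n : ℝ) - 2) / (n : ℝ)) := by
  have hn0 : 0 < n := by omega
  have hn3 : (3 : ℝ) ≤ n := by exact_mod_cast hn
  have hn1 : ((n - 1 : ℕ) : ℝ) = n - 1 := by rw [Nat.cast_sub (by omega)]; simp
  have hS : 0 ≤ sobolevConst n := by
    rw [sobolevConst]
    have := Gamma_pos_of_pos (show 0 < (n : ℝ) / 2 by positivity)
    have := Gamma_pos_of_pos (show 0 < (n : ℝ) by positivity)
    have : 0 ≤ (n : ℝ) - 2 := by linarith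
    have := pi_pos
    positivity
  obtain ⟨N, hN⟩ : ∃ N : ℝ, N = (n : ℝ) - 2 := ⟨_, rfl⟩
  have hN0 : 0 < N := by linarith
  obtain ⟨γ, hγ⟩ : ∃ γ : ℝ, γ = 2 * ((n : ℝ) - 1) / (n : ℝ) := ⟨_, rfl⟩
  obtain ⟨e, he⟩ : ∃ e : ℝ, e = ((n : ℝ) - 2) / (n : ℝ) := ⟨_, rfl⟩
  obtain ⟨β, hβ⟩ : ∃ β : ℝ, β = 2 * ((n : ℝ) - 1) / ((n : ℝ) - 2) := ⟨_, rfl⟩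
  obtain ⟨p, hp⟩ : ∃ p : ℝ, p = 2 * (n : ℝ) / ((n : ℝ) - 2) := ⟨_, rfl⟩
  have hp0 : 0 < p := by rw [hp, ← hN]; positivity
  have he0 : 0 ≤ e := by rw [he, ← hN]; positivity
  have hβ0 : 0 ≤ β := by rw [hβ, ← hN]; exact div_nonneg (by linarith) hN0.le
  have hβe : β * e = γ := by rw [hβ, he, hγ]; rw [hN] at hN0; field_simp
  have hγe : γ - e = 1 := by rw [he, hγ]; field_simp; ring
  have hC0 : 0 ≤ C := le_trans (by positivity) hC.le
  have hC' : ((n : ℝ) - 2) ^ (-(2 * ((n : ℝ) - 1)) / (n : ℝ)) * sobolevConst n <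
      N ^ (-γ) * (b ^ (-γ) * C) := by
    rw [neg_div, ← hγ, ← hN]
    refine mul_lt_mul_of_pos_left ?_ (rpow_pos_of_pos hN0 _)
    rw [rpow_neg hb.le, inv_mul_eq_div, lt_div_iff₀' (rpow_pos_of_pos hb _), hγ]
    exact hC
  obtain ⟨W, hW, ⟨t₁, t₂, ht₁, hs⟩, hlt⟩ := exists_profile hn hC'
  rw [← hβ, ← hp, ← he] at hlt
  rw [← hβ, ← hp, ← he]
  obtain ⟨μ, hμ⟩ : ∃ μ : ℝ, μ = t₁ * (r / 2) ^ N := ⟨_, rfl⟩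
  have hμ0 : 0 < μ := by rw [hμ]; positivity
  let h : ℝ → ℝ := fun ρ => W (μ * ρ ^ (-N))
  have hh : ContDiffOn ℝ (⊤ : ℕ∞) h (Set.Ioi 0) := by
    refine hW.comp_contDiffOn (contDiffOn_const.mul fun ρ hρ => ?_)
    exact (contDiffAt_rpow_const_of_ne (ne_of_gt hρ)).contDiffWithinAt
  have hT : 0 < max t₁ t₂ := ht₁.trans_le (le_max_left _ _)
  have hsupp : ∀ ρ > 0, h ρ ≠ 0 → ρ ∈ Set.Icc ((μ / max t₁ t₂) ^ N⁻¹) (r / 2) := fun ρ hρ hne => by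
    have h1 := hs _ hne
    have hρN : 0 < ρ ^ N := rpow_pos_of_pos hρ _
    rw [rpow_neg hρ.le, ← div_eq_mul_inv, Set.mem_Icc, le_div_iff₀ hρN, div_le_iff₀ hρN] at h1
    constructor
    · rw [rpow_inv_le_iff_of_pos (by positivity) hρ.le hN0, div_le_iff₀' hT]
      exact h1.2.trans (mul_le_mul_of_nonneg_right (le_max_right _ _) hρN.le)
    · rw [← rpow_le_rpow_iff hρ.le (by positivity) hN0]
      rw [hμ] at h1
      exact le_of_mul_le_mul_left h1.1 ht₁
  let g : ℝ → ℝ := (Set.Ioi 0).indicator h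
  have hr₁ : 0 < (μ / max t₁ t₂) ^ N⁻¹ := by positivity
  have hg : ContDiff ℝ (⊤ : ℕ∞) g := contDiff_indicator_Ioi hr₁ hh hsupp
  have hgs := support_indicator_Ioi hsupp
  have hgr : ∀ ρ : ℝ, 0 < ρ → g ρ = W (μ * ρ ^ (-N)) := fun ρ hρ => Set.indicator_of_mem hρ h
  have hdg : ∀ ρ : ℝ, 0 < ρ →
      deriv g ρ = deriv W (μ * ρ ^ (-N)) * (μ * (-N * ρ ^ (-N - 1))) := fun ρ hρ => by
    rw [deriv_indicator_Ioi h hρ]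
    have h2 : HasDerivAt h _ ρ := (hW.differentiable (by simp) (μ * ρ ^ (-N))).hasDerivAt.comp ρ
      ((hasDerivAt_rpow_const (p := -N) (Or.inl hρ.ne')).const_mul μ)
    exact h2.deriv
  have hball : ∀ x, x ∈ tsupport (fun x => g ‖x - x₀‖) → x ∈ Metric.ball x₀ r := fun x hx => by
    have := (tsupport_radial_subset hgs x₀ hx).2
    rw [Metric.mem_ball, dist_eq_norm]
    linarith
  have hts : tsupport (fun x => g ‖x - x₀‖) ⊆ Ω := fun x hx => hΩ (hball x hx)
  have hoff : ∀ x ∉ Ω, g ‖x - x₀‖ = 0 := fun x hx => by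
    by_contra hne
    exact hx (hts (subset_tsupport _ hne))
  have hu := contDiff_radial hg hr₁ hgs x₀
  have huc := hasCompactSupport_radial hgs x₀
  refine ⟨fun x => g ‖x - x₀‖, hu, huc, hts, ?_⟩
  have hE : (∫ x in Ω, ‖gradient (fun x => g ‖x - x₀‖) x‖ ^ 2) =
      μ * N * (sphereArea n * ∫ t in Set.Ioi (0 : ℝ), deriv W t ^ 2) := by
    rw [setIntegral_gradient_sq_radial hn0 hg hr₁ hgs x₀ hts,
      setIntegral_congr_fun (g := fun ρ => (μ * N) ^ 2 *
        (ρ ^ (-N - 1) * deriv W (μ * ρ ^ (-N)) ^ 2)) measurableSet_Ioi fun ρ hρ => ?_,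
      integral_const_mul, integral_comp_mul_rpow_neg hN0 hμ0 (fun t => deriv W t ^ 2)]
    · field_simp
    · have hρ : 0 < ρ := hρ
      have e : ρ ^ (n - 1) * (ρ ^ (-N - 1)) ^ 2 = ρ ^ (-N - 1) := by
        rw [← rpow_natCast, ← rpow_natCast (ρ ^ (-N - 1)), ← rpow_mul hρ.le, ← rpow_add hρ, hn1, hN]
        congr 1
        push_cast
        ring
      simp only [hdg ρ hρ]
      linear_combination (deriv W (μ * ρ ^ (-N))) ^ 2 * (μ * N) ^ 2 * e
  have hP : (∫ x in Ω, |g ‖x - x₀‖| ^ p) = (N * μ)⁻¹ * μ ^ β *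
      (sphereArea n * ∫ t in Set.Ioi (0 : ℝ), t ^ (-β) * |W t| ^ p) := by
    rw [setIntegral_radial hn0 (fun ρ => |g ρ| ^ p) x₀
        (fun x hx => by simp only [hoff x hx]; simp [zero_rpow hp0.ne']),
      setIntegral_congr_fun (g := fun ρ => μ ^ β *
        (ρ ^ (-N - 1) * ((μ * ρ ^ (-N)) ^ (-β) * |W (μ * ρ ^ (-N))| ^ p)))
        measurableSet_Ioi fun ρ hρ => ?_,
      integral_const_mul, integral_comp_mul_rpow_neg hN0 hμ0 (fun t => t ^ (-β) * |W t| ^ p)]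
    · ring
    · have hρ : 0 < ρ := hρ
      have e : μ ^ β * (ρ ^ (-N - 1) * (μ * ρ ^ (-N)) ^ (-β)) = ρ ^ (n - 1) := by
        rw [mul_rpow hμ0.le (rpow_nonneg hρ.le _), mul_left_comm, ← mul_assoc (μ ^ β),
          ← rpow_add hμ0, add_neg_cancel, rpow_zero, one_mul, ← rpow_mul hρ.le, ← rpow_add hρ,
          ← rpow_natCast, hn1]
        congr 1
        have : N * β = 2 * (n - 1) := by rw [hβ, ← hN]; field_simp
        linarith
      simp only [hgr ρ hρ]
      rw [← e]
      ring
  have hH : 0 ≤ ∫ x in Ω, (g ‖x - x₀‖) ^ 2 / ‖x‖ ^ 2 :=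
    integral_nonneg fun x => by positivity
  have hB0 : 0 ≤ ∫ t in Set.Ioi (0 : ℝ), t ^ (-β) * |W t| ^ p :=
    setIntegral_nonneg measurableSet_Ioi fun t ht =>
      mul_nonneg (rpow_nonneg (le_of_lt ht) _) (rpow_nonneg (abs_nonneg _) _)
  have hω := sphereArea_pos hn0
  have hint : Integrable (fun x => |g ‖x - x₀‖| ^ p) := by
    refine (hu.continuous.abs.rpow_const fun _ => Or.inr hp0.le).integrable_of_hasCompactSupport ?_
    exact huc.comp_left (g := fun y => |y| ^ p) (by simp [zero_rpow hp0.ne'])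
  have hle : b ^ (-β) * (∫ x in Ω, |g ‖x - x₀‖| ^ p) ≤
      ∫ x in Ω, X1 a (‖x‖ / D) ^ β * |g ‖x - x₀‖| ^ p := by
    rw [← integral_const_mul]
    refine setIntegral_mono_on (hint.integrableOn.const_mul _) ?_ hΩo.measurableSet fun x hx => ?_
    · refine Integrable.mono' (hint.integrableOn.const_mul (a⁻¹ ^ β)) ?_ ?_
      · refine Measurable.aestronglyMeasurable ?_
        unfold X1
        refine Measurable.mul (by fun_prop) ?_
        exact (hu.continuous.abs.rpow_const fun _ => Or.inr hp0.le).measurable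
      · refine (ae_restrict_iff' hΩo.measurableSet).2 (Filter.Eventually.of_forall fun x hx => ?_)
        have h1 := rpow_nonneg (hX x hx).1 β
        have h2 := rpow_nonneg (abs_nonneg (g ‖x - x₀‖)) p
        rw [norm_of_nonneg (mul_nonneg h1 h2)]
        exact mul_le_mul_of_nonneg_right (rpow_le_rpow (hX x hx).1 (hX x hx).2 hβ0) h2
    · by_cases hne : g ‖x - x₀‖ = 0
      · rw [hne]
        simp [zero_rpow hp0.ne']
      · refine mul_le_mul_of_nonneg_right ?_ (rpow_nonneg (abs_nonneg _) _)
        rw [rpow_neg hb.le, ← inv_rpow hb.le]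
        exact rpow_le_rpow (by positivity) (hXb x (hball x (subset_tsupport _ hne))) hβ0
  rw [hP] at hle
  rw [hE]
  have hpow : (b ^ (-β) * ((N * μ)⁻¹ * μ ^ β *
      (sphereArea n * ∫ t in Set.Ioi (0 : ℝ), t ^ (-β) * |W t| ^ p))) ^ e =
      μ * N * (N ^ (-γ) * b ^ (-γ)) *
        (sphereArea n * ∫ t in Set.Ioi (0 : ℝ), t ^ (-β) * |W t| ^ p) ^ e := by
    have hBω := mul_nonneg hω.le hB0
    generalize sphereArea n * ∫ t in Set.Ioi (0 : ℝ), t ^ (-β) * |W t| ^ p = B at hBω ⊢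
    rw [mul_rpow (by positivity) (by positivity), mul_rpow (by positivity) hBω,
      mul_rpow (by positivity) (by positivity), inv_rpow (by positivity),
      mul_rpow hN0.le hμ0.le, ← rpow_mul hb.le, ← rpow_mul hμ0.le, neg_mul, hβe,
      show γ = 1 + e by linarith, rpow_add hμ0, rpow_neg hN0.le, rpow_add hN0, rpow_one, rpow_one]
    have := rpow_pos_of_pos hN0 e
    have := rpow_pos_of_pos hμ0 e
    field_simp
  calc _ ≤ μ * N * (sphereArea n * ∫ t in Set.Ioi (0 : ℝ), deriv W t ^ 2) :=
        sub_le_self _ (by positivity)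
    _ < μ * N * _ := mul_lt_mul_of_pos_left hlt (by positivity)
    _ = C * _ ^ e := by rw [hpow]; ring
    _ ≤ _ := mul_le_mul_of_nonneg_left (rpow_le_rpow (by positivity) hle he0) hC0

theorem stmt15 (n : ℕ) (hn : 3 ≤ n)
    (Ω : Set (EuclideanSpace ℝ (Fin n))) (hΩo : IsOpen Ω) (hΩc : IsConnected Ω)
    (hΩb : Bornology.IsBounded Ω) (h0 : (0 : EuclideanSpace ℝ (Fin n)) ∈ Ω)
    (D : ℝ) (hD : D = sSup ((fun x : EuclideanSpace ℝ (Fin n) => ‖x‖) '' Ω))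
    (a : ℝ) (ha0 : 0 < a)
    (Cna : ℝ)
    (hCna : Cna = if 1 / ((n : ℝ) - 2) ≤ a then ((n : ℝ) - 2) ^ (-(2 * ((n : ℝ) - 1)) / (n : ℝ)) * sobolevConst n else a ^ (2 * ((n : ℝ) - 1) / (n : ℝ)) * sobolevConst n)
    (C : ℝ) (hC : C > Cna) :
    ∃ u : EuclideanSpace ℝ (Fin n) → ℝ, u ≠ 0 ∧ ContDiff ℝ (⊤ : ℕ∞) u ∧ HasCompactSupport u ∧
      tsupport u ⊆ Ω ∧
      (∫ x in Ω, ‖gradient u x‖ ^ 2) - (((n : ℝ) - 2) / 2) ^ 2 *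
          (∫ x in Ω, u x ^ 2 / ‖x‖ ^ 2)
        < C *
          (∫ x in Ω,
              (X1 a (‖x‖ / D)) ^ (2 * ((n : ℝ) - 1) / ((n : ℝ) - 2)) *
                |u x| ^ (2 * (n : ℝ) / ((n : ℝ) - 2)))
            ^ (((n : ℝ) - 2) / (n : ℝ)) := by
  have hn3 : (3 : ℝ) ≤ n := by exact_mod_cast hn
  have hbdd : BddAbove ((fun x : EuclideanSpace ℝ (Fin n) => ‖x‖) '' Ω) := by
    obtain ⟨M, hM⟩ := hΩb.exists_norm_le
    exact ⟨M, by rintro _ ⟨x, hx, rfl⟩; exact hM x hx⟩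
  have hle : ∀ x ∈ Ω, ‖x‖ ≤ D := fun x hx => hD ▸ le_csSup hbdd ⟨x, hx, rfl⟩
  obtain ⟨R, hR, hRΩ⟩ := Metric.isOpen_iff.1 hΩo 0 h0
  have hD0 : 0 < D := by
    have : Nonempty (Fin n) := ⟨⟨0, by omega⟩⟩
    obtain ⟨x, hx⟩ := exists_norm_eq (EuclideanSpace ℝ (Fin n)) (half_pos hR).le
    refine lt_of_lt_of_le (half_pos hR) (hx ▸ hle x (hRΩ ?_))
    rw [Metric.mem_ball, dist_zero_right, hx]
    linarith
  suffices H : ∃ u : EuclideanSpace ℝ (Fin n) → ℝ, ContDiff ℝ (⊤ : ℕ∞) u ∧ HasCompactSupport u ∧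
      tsupport u ⊆ Ω ∧
      (∫ x in Ω, ‖gradient u x‖ ^ 2) - (((n : ℝ) - 2) / 2) ^ 2 *
          (∫ x in Ω, u x ^ 2 / ‖x‖ ^ 2)
        < C *
          (∫ x in Ω,
              (X1 a (‖x‖ / D)) ^ (2 * ((n : ℝ) - 1) / ((n : ℝ) - 2)) *
                |u x| ^ (2 * (n : ℝ) / ((n : ℝ) - 2)))
            ^ (((n : ℝ) - 2) / (n : ℝ)) by
    obtain ⟨u, h1, h2, h3, h4⟩ := H
    refine ⟨u, ?_, h1, h2, h3, h4⟩
    rintro rfl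
    have hN : 0 < (n : ℝ) - 2 := by linarith
    have e1 : 2 * (n : ℝ) / ((n : ℝ) - 2) ≠ 0 := by positivity
    have e2 : ((n : ℝ) - 2) / (n : ℝ) ≠ 0 := by positivity
    have e3 : ∀ x, gradient (0 : EuclideanSpace ℝ (Fin n) → ℝ) x = 0 := fun x => by
      simp [gradient]
    simp [e3, zero_rpow e1, zero_rpow e2] at h4
  rw [hCna] at hC
  split_ifs at hC with hcase
  · exact exists_test_origin hn hD0 hR hRΩ hC
  · have hcont : ContinuousAt (fun b : ℝ => b ^ (2 * ((n : ℝ) - 1) / (n : ℝ)) * sobolevConst n) a :=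
      (continuousAt_rpow_const a _ (Or.inl ha0.ne')).mul_const _
    obtain ⟨b, hbC, hab⟩ := ((hcont.eventually_lt_const hC).filter_mono
      nhdsWithin_le_nhds |>.and (self_mem_nhdsWithin (s := Set.Ioi a))).exists
    have hab : a < b := hab
    have hlt : D * exp (a - b) < D :=
      mul_lt_of_lt_one_right hD0 (exp_lt_one_iff.2 (by linarith))
    obtain ⟨_, ⟨x₀, hx₀, rfl⟩, hx₀D⟩ := exists_lt_of_lt_csSup
      (Set.Nonempty.image _ ⟨0, h0⟩) (hlt.trans_eq hD)
    obtain ⟨r, hr, hrΩ⟩ := Metric.isOpen_iff.1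
      (hΩo.inter (isOpen_lt continuous_const continuous_norm)) x₀ ⟨hx₀, hx₀D⟩
    have hlog : ∀ x ∈ Ω, a ≤ a - log (‖x‖ / D) := fun x hx => by
      have := log_nonpos (by positivity) ((div_le_one hD0).2 (hle x hx))
      linarith
    refine exists_test_near hn (ha0.trans hab) hr hΩo (fun x hx => (hrΩ hx).1)
      (fun x hx => ?_) (fun x hx => ?_) hbC
    · have := hlog x hx
      exact ⟨inv_nonneg.2 (ha0.le.trans this), inv_anti₀ ha0 this⟩
    · have h1 := hlog x (hrΩ hx).1
      have h2 : D * exp (a - b) < ‖x‖ := (hrΩ hx).2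
      refine inv_anti₀ (ha0.trans_le h1) ?_
      have h3 : a - b < log (‖x‖ / D) := by
        rw [lt_log_iff_exp_lt (div_pos (lt_trans (by positivity) h2) hD0), lt_div_iff₀' hD0]
        exact h2
      linarith
end

section
/- Let n ≥ 3 and b > 0. Then for every u ∈ C_c^∞(ℝ^n), ∫_{ℝ^n} |x|^{2b} |∇u|² dx ≥ S_n · ( ∫_{ℝ^n} |x|^{2bn/(n-2)} |u|^{2n/(n-2)} dx )^{(n-2)/n}; that is, the best constant S_n(b) in this Caffarelli–Kohn–Nirenberg inequality equals the Sobolev constant S_n. -/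
open MeasureTheory Real

section CaffarelliKohnNirenberg

open Set Filter Topology

/-- One-dimensional monotone transport between two positive continuous densities of equal mass. -/
theorem exists_monotone_transport {R : ℝ} (hR : 0 < R) {f g : ℝ → ℝ} (hf : Continuous f)
    (hg : Continuous g) (hf0 : ∀ x, 0 < f x) (hg0 : ∀ x, 0 < g x)
    (hfg : ∫ x in (-R)..R, f x = ∫ x in (-R)..R, g x) :
    ∃ T d : ℝ → ℝ, Continuous d ∧ (∀ x, HasDerivAt T (d x) x) ∧ T (-R) = -R ∧ T R = R ∧
      (∀ x, 0 < d x) ∧ ∀ x ∈ Icc (-R) R, f x = d x * g (T x) := by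
  have hRR : -R ≤ R := by linarith
  set f' : ℝ → ℝ := IccExtend hRR (fun x : Icc (-R) R => f x) with hf'
  set g' : ℝ → ℝ := IccExtend hRR (fun x : Icc (-R) R => g x) with hg'
  have cf' : Continuous f' := (hf.comp continuous_subtype_val).Icc_extend'
  have cg' : Continuous g' := (hg.comp continuous_subtype_val).Icc_extend'
  have ef : ∀ x ∈ Icc (-R) R, f' x = f x := fun x hx => by
    simp [hf', IccExtend_of_mem hRR _ hx]
  have eg : ∀ x ∈ Icc (-R) R, g' x = g x := fun x hx => by
    simp [hg', IccExtend_of_mem hRR _ hx]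
  have pf : ∀ x, 0 < f' x := fun x => hf0 _
  have pg : ∀ x, 0 < g' x := fun x => hg0 _
  obtain ⟨m, hm, hmg⟩ : ∃ m, 0 < m ∧ ∀ x, m ≤ g' x := by
    obtain ⟨z, -, hz⟩ := isCompact_Icc.exists_isMinOn (nonempty_Icc.2 hRR) hg.continuousOn
    exact ⟨g z, hg0 z, fun x => hz (Subtype.mem _)⟩
  set A : ℝ → ℝ := fun x => ∫ t in (-R)..x, f' t with hA
  set B : ℝ → ℝ := fun x => ∫ t in (-R)..x, g' t with hB
  have dA : ∀ x, HasDerivAt A (f' x) x := fun x => cf'.integral_hasStrictDerivAt _ _ |>.hasDerivAt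
  have dB : ∀ x, HasDerivAt B (g' x) x := fun x => cg'.integral_hasStrictDerivAt _ _ |>.hasDerivAt
  have mB : StrictMono B := strictMono_of_deriv_pos fun x => by rw [(dB x).deriv]; exact pg x
  have cB : Continuous B := continuous_iff_continuousAt.2 fun x => (dB x).continuousAt
  have mono : Monotone fun x => B x - m * x := by
    have hd : ∀ x, HasDerivAt (fun x => B x - m * x) (g' x - m) x := fun x => by
      simpa using! (dB x).sub ((hasDerivAt_id x).const_mul m)
    refine monotone_of_deriv_nonneg (fun x => (hd x).differentiableAt) fun x => ?_
    rw [(hd x).deriv]; linarith [hmg x]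
  have sB : Function.Surjective B := by
    refine cB.surjective ?_ ?_
    · refine tendsto_atTop_mono' _ (f₁ := fun x => B 0 + m * x) ?_ ?_
      · filter_upwards [eventually_ge_atTop 0] with x hx
        have := mono hx
        simp only at this; linarith
      · exact tendsto_atTop_add_const_left _ _ (tendsto_id.const_mul_atTop hm)
    · refine tendsto_atBot_mono' _ (f₁ := fun x => B 0 + m * x) ?_ ?_
      · filter_upwards [eventually_le_atBot 0] with x hx
        have := mono hx
        simp only at this; linarith
      · exact tendsto_atBot_add_const_left _ _ (tendsto_id.const_mul_atBot hm)
  set e := mB.orderIsoOfSurjective B sB with he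
  have eB : ∀ x, e x = B x := fun x => rfl
  have hTB : ∀ y, B (e.symm y) = y := fun y => e.apply_symm_apply y
  have hBT : ∀ y, e.symm (B y) = y := fun y => e.symm_apply_apply y
  have dT : ∀ x, HasDerivAt (fun x => e.symm (A x)) ((g' (e.symm (A x)))⁻¹ * f' x) x := fun x => by
    have h1 : HasDerivAt (fun y => e.symm y) (g' (e.symm (A x)))⁻¹ (A x) :=
      (dB _).of_local_left_inverse e.symm.continuous.continuousAt (pg _).ne'
        (Eventually.of_forall hTB)
    exact h1.comp x (dA x)
  have cA : Continuous A := continuous_iff_continuousAt.2 fun x => (dA x).continuousAt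
  have cT : Continuous fun x => e.symm (A x) := e.symm.continuous.comp cA
  have T1 : e.symm (A (-R)) = -R := by
    have : A (-R) = B (-R) := by simp [hA, hB]
    rw [this, hBT]
  have T2 : e.symm (A R) = R := by
    have : A R = B R := by
      simp only [hA, hB]
      rw [intervalIntegral.integral_congr (g := f),
        intervalIntegral.integral_congr (f := g') (g := g), hfg]
      · intro x hx; rw [uIcc_of_le hRR] at hx; exact eg x hx
      · intro x hx; rw [uIcc_of_le hRR] at hx; exact ef x hx
    rw [this, hBT]
  have mA : StrictMono A := strictMono_of_deriv_pos fun x => by rw [(dA x).deriv]; exact pf x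
  refine ⟨fun x => e.symm (A x), fun x => (g' (e.symm (A x)))⁻¹ * f' x, ?_, dT, T1, T2,
    fun x => mul_pos (inv_pos.2 (pg _)) (pf x), fun x hx => ?_⟩
  · exact ((cg'.comp cT).inv₀ fun x => (pg _).ne').mul cf'
  · have hTx : e.symm (A x) ∈ Icc (-R) R := by
      constructor
      · calc -R = e.symm (A (-R)) := T1.symm
          _ ≤ _ := e.symm.monotone (mA.monotone hx.1)
      · calc _ ≤ e.symm (A R) := e.symm.monotone (mA.monotone hx.2)
          _ = R := T2
    simp only
    rw [ef x hx, eg _ hTx]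
    field_simp [(hg0 (e.symm (A x))).ne']

/-- The cube `[-R, R]^k`. -/
def cube (k : ℕ) (R : ℝ) : Set (Fin k → ℝ) := Icc (fun _ => -R) (fun _ => R)

theorem isCompact_cube (k : ℕ) (R : ℝ) : IsCompact (cube k R) := isCompact_Icc

theorem mem_cube {k : ℕ} {R : ℝ} {x : Fin k → ℝ} : x ∈ cube k R ↔ ∀ i, x i ∈ Icc (-R) R := by
  simp [cube, Pi.le_def, forall_and]

theorem measurableSet_cube (k : ℕ) (R : ℝ) : MeasurableSet (cube k R) := measurableSet_Icc

theorem integrableOn_cube {k : ℕ} {R : ℝ} {f : (Fin k → ℝ) → ℝ} (hf : Continuous f) :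
    IntegrableOn f (cube k R) := hf.continuousOn.integrableOn_compact (isCompact_cube k R)

theorem volume_real_cube {k : ℕ} {R : ℝ} (hR : 0 < R) : volume.real (cube k R) = (2 * R) ^ k := by
  have : (fun _ : Fin k => -R) ≤ fun _ => R := fun _ => by simp; linarith
  rw [Measure.real, cube, Real.volume_Icc_pi_toReal this]
  simp; ring

theorem continuous_cons {k : ℕ} :
    Continuous (fun p : ℝ × (Fin k → ℝ) => (Fin.cons p.1 p.2 : Fin (k + 1) → ℝ)) := by
  fun_prop

theorem setIntegral_cube_succ {k : ℕ} {R : ℝ} (hR : 0 < R) {f : (Fin (k + 1) → ℝ) → ℝ}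
    (hf : Continuous f) :
    ∫ x in cube (k + 1) R, f x = ∫ t in (-R)..R, ∫ y in cube k R, f (Fin.cons t y) := by
  have hp := (volume_preserving_piFinSuccAbove (fun _ : Fin (k + 1) => ℝ) 0).symm
  have hset : (MeasurableEquiv.piFinSuccAbove (fun _ : Fin (k + 1) => ℝ) 0).symm ⁻¹'
      cube (k + 1) R = Icc (-R) R ×ˢ cube k R := by
    ext ⟨t, y⟩
    simp [mem_cube, MeasurableEquiv.piFinSuccAbove_symm_apply, Fin.forall_fin_succ,
      Fin.insertNthEquiv, and_assoc]
  rw [← hp.setIntegral_preimage_emb (MeasurableEquiv.measurableEmbedding _), hset,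
    intervalIntegral.integral_of_le (by linarith), ← integral_Icc_eq_integral_Ioc]
  have hc : Continuous fun p : ℝ × (Fin k → ℝ) => f (Fin.cons p.1 p.2) := hf.comp continuous_cons
  have := setIntegral_prod (μ := (volume : Measure ℝ)) (ν := (volume : Measure (Fin k → ℝ)))
    (s := Icc (-R) R) (t := cube k R)
    (fun p : ℝ × (Fin k → ℝ) => f (Fin.cons p.1 p.2))
    (hc.continuousOn.integrableOn_compact (isCompact_Icc.prod (isCompact_cube k R)))
  rw [← this]
  congr 1
  ext p
  simp [MeasurableEquiv.piFinSuccAbove_symm_apply, Fin.insertNthEquiv]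

theorem continuous_setIntegral_cube {k : ℕ} {R : ℝ} {f : (Fin (k + 1) → ℝ) → ℝ}
    (hf : Continuous f) : Continuous fun t => ∫ y in cube k R, f (Fin.cons t y) :=
  continuous_parametric_integral_of_continuous (f := fun t y => f (Fin.cons t y)) (hf.comp continuous_cons) (isCompact_cube k R)

theorem hasDerivAt_setIntegral_cube {k : ℕ} {R : ℝ} {f f' : (Fin (k + 1) → ℝ) → ℝ}
    (hf : Continuous f) (hf' : Continuous f')
    (hd : ∀ t y, HasDerivAt (fun s => f (Fin.cons s y)) (f' (Fin.cons t y)) t) (t : ℝ) :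
    HasDerivAt (fun t => ∫ y in cube k R, f (Fin.cons t y)) (∫ y in cube k R, f' (Fin.cons t y))
      t := by
  have hc : Continuous fun p : ℝ × (Fin k → ℝ) => f' (Fin.cons p.1 p.2) := hf'.comp continuous_cons
  obtain ⟨C, hC⟩ := ((isCompact_closedBall t 1).prod (isCompact_cube k R)).exists_bound_of_continuousOn
    hc.continuousOn
  have cs : ∀ {g : (Fin (k + 1) → ℝ) → ℝ}, Continuous g → ∀ t : ℝ,
      Continuous fun y : Fin k → ℝ => g (Fin.cons t y) := fun hg t =>
    hg.comp (continuous_cons.comp (Continuous.prodMk_right t))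
  refine (hasDerivAt_integral_of_dominated_loc_of_deriv_le (μ := volume.restrict (cube k R))
    (F := fun t y => f (Fin.cons t y)) (F' := fun t y => f' (Fin.cons t y)) (bound := fun _ => C)
    (Metric.closedBall_mem_nhds t one_pos)
    (Eventually.of_forall fun s => (cs hf s).aestronglyMeasurable) (integrableOn_cube (cs hf t))
    (cs hf' t).aestronglyMeasurable ?_ ?_ ?_).2
  · filter_upwards [ae_restrict_mem (measurableSet_cube k R)] with y hy s hs
    exact hC (s, y) ⟨hs, hy⟩
  · exact integrableOn_const (isCompact_cube k R).measure_lt_top.ne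
  · exact Eventually.of_forall fun y s _ => hd s y

theorem rpow_interpolate {N k : ℕ} (hk : k + 1 ≤ N) {c d : ℝ} (hc : 0 < c) (hd : 0 < d) :
    c ^ (((N : ℝ) - (k + 1 : ℕ)) / N) * d ^ (1 / (N : ℝ)) ≤
      ((((N : ℝ) - (k + 1 : ℕ)) * c + d) / (N - k)) ^ (((N : ℝ) - k) / N) := by
  have hk' : (k : ℝ) + 1 ≤ N := by exact_mod_cast hk
  have hNk : 0 < (N : ℝ) - k := by linarith
  have hN : 0 < (N : ℝ) := by have : (0 : ℝ) ≤ k := k.cast_nonneg; linarith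
  push_cast
  have h := Real.geom_mean_le_arith_mean2_weighted (w₁ := ((N : ℝ) - (k + 1)) / (N - k))
    (w₂ := 1 / (N - k)) (p₁ := c) (p₂ := d) (by apply div_nonneg <;> linarith) (by positivity) hc.le
    hd.le (by field_simp; ring)
  have h2 := Real.rpow_le_rpow (by positivity) h (by positivity : 0 ≤ ((N : ℝ) - k) / N)
  rw [Real.mul_rpow (by positivity) (by positivity), ← Real.rpow_mul hc.le,
    ← Real.rpow_mul hd.le] at h2
  convert h2 using 2
  · congr 1; field_simp
  · congr 1; field_simp
  · field_simp

theorem cube_transport_inequality {N : ℕ} {R η l : ℝ} (hR : 0 < R) (hl : 0 < l) :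
    ∀ k ≤ N, ∀ (F G H : (Fin k → ℝ) → ℝ) (D : Fin k → (Fin k → ℝ) → ℝ) (c : ℝ), 0 < c →
      Continuous F → Continuous G → (∀ x, 0 < F x) → (∀ x, 0 < G x) →
      (∀ x, H x = F x ^ (1 - 1 / (N : ℝ))) → (∀ i, Continuous (D i)) →
      (∀ i x, HasDerivAt (fun t => H (Function.update x i t)) (D i x) (x i)) →
      (∀ x ∈ cube k R, ∀ i, |x i| = R → H x ≤ η) →
      ∫ x in cube k R, F x = ∫ x in cube k R, G x →
      N * c ^ (((N : ℝ) - k) / N) * ∫ x in cube k R, G x ^ (1 - 1 / (N : ℝ)) ≤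
        (N - k) * c * (∫ x in cube k R, H x) + l / 2 * (∫ x in cube k R, (∑ i, D i x ^ 2) / F x) +
        1 / (2 * l) * (∫ x in cube k R, G x * ∑ i, x i ^ 2) + k * (η * (2 * R) ^ k) := by
  intro k
  induction k with
  | zero =>
    intro _ F G H D c hc cF cG pF pG hH cD hD hb hm
    have hv : (volume : Measure (Fin 0 → ℝ)).real (cube 0 R) = 1 := by
      simpa using volume_real_cube (k := 0) hR
    have hi : ∀ f : (Fin 0 → ℝ) → ℝ, ∫ x in cube 0 R, f x = f 0 := fun f => by
      have : f = fun _ => f 0 := by ext x; congr; ext i; exact i.elim0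
      rw [this]
      simp [hv]
    simp only [hi] at hm ⊢
    rcases Nat.eq_zero_or_pos N with rfl | hN
    · simp
    have : (N : ℝ) ≠ 0 := by positivity
    rw [hH, hm]
    simp [this]
  | succ k ih =>
    intro hk F G H D c hc cF cG pF pG hH cD hD hb hm
    have hk' : (k : ℝ) + 1 ≤ N := by exact_mod_cast hk
    have hNk : 0 < (N : ℝ) - k := by linarith
    have hN : 0 < (N : ℝ) := by have : (0 : ℝ) ≤ k := k.cast_nonneg; linarith
    have hRR : -R ≤ R := by linarith
    have cs : ∀ {g : (Fin (k + 1) → ℝ) → ℝ}, Continuous g → ∀ t : ℝ,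
        Continuous fun y : Fin k → ℝ => g (Fin.cons t y) := fun hg t =>
      hg.comp (continuous_cons.comp (Continuous.prodMk_right t))
    have cH : Continuous H := by
      rw [show H = fun x => F x ^ (1 - 1 / (N : ℝ)) from funext hH]
      exact cF.rpow_const fun x => Or.inl (pF x).ne'
    have pH : ∀ x, 0 < H x := fun x => by rw [hH]; exact Real.rpow_pos_of_pos (pF x) _
    have cG1 : Continuous fun x => G x ^ (1 - 1 / (N : ℝ)) :=
      cG.rpow_const fun x => Or.inl (pG x).ne'
    have pI : ∀ {g : (Fin (k + 1) → ℝ) → ℝ}, Continuous g → (∀ x, 0 < g x) → ∀ t,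
        0 < ∫ y in cube k R, g (Fin.cons t y) := fun {g} hg hg0 t => by
      obtain ⟨z, -, hz⟩ := (isCompact_cube k R).exists_isMinOn ⟨0, by simp [mem_cube, hR.le]⟩
        (cs hg t).continuousOn
      have h1 : ∫ y in cube k R, g (Fin.cons t z) ≤ ∫ y in cube k R, g (Fin.cons t y) :=
        setIntegral_mono_on (integrableOn_const (isCompact_cube k R).measure_lt_top.ne)
          (integrableOn_cube (cs hg t)) (measurableSet_cube k R) fun y hy => hz hy
      refine lt_of_lt_of_le ?_ h1
      simp only [setIntegral_const, volume_real_cube hR, smul_eq_mul]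
      exact mul_pos (by positivity) (hg0 _)
    obtain ⟨T, d, cd, dT, T1, T2, pd, hT⟩ := exists_monotone_transport hR
      (continuous_setIntegral_cube (R := R) cF) (continuous_setIntegral_cube (R := R) cG)
      (pI cF pF) (pI cG pG) (by rw [← setIntegral_cube_succ hR cF, hm, setIntegral_cube_succ hR cG])
    have cT : Continuous T := continuous_iff_continuousAt.2 fun x => (dT x).continuousAt
    -- the marginal integrals entering the estimate
    set g1 : ℝ → ℝ := fun s => ∫ y in cube k R, G (Fin.cons s y) ^ (1 - 1 / (N : ℝ)) with hg1
    set g2 : ℝ → ℝ := fun s => ∫ y in cube k R, G (Fin.cons s y) * ∑ i, y i ^ 2 with hg2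
    set Gm : ℝ → ℝ := fun s => ∫ y in cube k R, G (Fin.cons s y) with hGm
    set Fm : ℝ → ℝ := fun s => ∫ y in cube k R, F (Fin.cons s y) with hFm
    set h : ℝ → ℝ := fun s => ∫ y in cube k R, H (Fin.cons s y) with hh
    set h' : ℝ → ℝ := fun s => ∫ y in cube k R, D 0 (Fin.cons s y) with hh'
    set q : ℝ → ℝ := fun s => ∫ y in cube k R, (∑ i : Fin k, D i.succ (Fin.cons s y) ^ 2) /
      F (Fin.cons s y) with hq
    set q0 : ℝ → ℝ := fun s => ∫ y in cube k R, D 0 (Fin.cons s y) ^ 2 / F (Fin.cons s y) with hq0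
    have cg1 : Continuous g1 := continuous_setIntegral_cube cG1
    have cGt : Continuous fun x : Fin (k + 1) → ℝ => G x * ∑ i, x (Fin.succ i) ^ 2 := by fun_prop
    have cg2 : Continuous g2 := by
      simpa using! continuous_setIntegral_cube (R := R) cGt
    have cGm : Continuous Gm := continuous_setIntegral_cube cG
    have cFm : Continuous Fm := continuous_setIntegral_cube cF
    have ch : Continuous h := continuous_setIntegral_cube cH
    have ch' : Continuous h' := continuous_setIntegral_cube (cD 0)
    have cQ : Continuous fun x => (∑ i : Fin k, D i.succ x ^ 2) / F x :=
      (continuous_finsetSum _ fun i _ => (cD _).pow 2).div cF fun x => (pF x).ne'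
    have cq : Continuous q := continuous_setIntegral_cube cQ
    have cQ0 : Continuous fun x => D 0 x ^ 2 / F x := ((cD 0).pow 2).div cF fun x => (pF x).ne'
    have cq0 : Continuous q0 := continuous_setIntegral_cube cQ0
    have slice : ∀ t ∈ Icc (-R) R,
        N * c ^ (((N : ℝ) - (k + 1 : ℕ)) / N) * (g1 (T t) * d t) ≤
          (N - (k + 1 : ℕ)) * c * h t + d t * h t + l / 2 * q t + 1 / (2 * l) * (g2 (T t) * d t) +
            k * (η * (2 * R) ^ k) := by
      intro t ht
      have hc' : 0 < (((N : ℝ) - (k + 1 : ℕ)) * c + d t) / (N - k) := by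
        refine div_pos (add_pos_of_nonneg_of_pos (mul_nonneg ?_ hc.le) (pd t)) hNk
        push_cast; linarith
      have := ih (by omega) (fun y => F (Fin.cons t y)) (fun y => d t * G (Fin.cons (T t) y))
        (fun y => H (Fin.cons t y)) (fun i y => D i.succ (Fin.cons t y)) _ hc' (cs cF t)
        ((cs cG _).const_mul _) (fun y => pF _) (fun y => mul_pos (pd t) (pG _)) (fun y => hH _)
        (fun i => cs (cD _) t) (fun i y => by simpa using! hD i.succ (Fin.cons t y))
        (fun y hy i hi => by
          refine hb _ ?_ i.succ (by simpa using hi)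
          rw [mem_cube] at hy ⊢
          intro j
          refine Fin.cases ?_ (fun j => ?_) j
          · simpa using ht
          · simpa using hy j)
        (by rw [integral_const_mul]; exact hT t ht)
      have e1 : ∫ y in cube k R, (d t * G (Fin.cons (T t) y)) ^ (1 - 1 / (N : ℝ)) =
          d t ^ (1 - 1 / (N : ℝ)) * g1 (T t) := by
        rw [hg1, ← integral_const_mul]
        congr 1; ext y
        exact Real.mul_rpow (pd t).le (pG _).le
      have e2 : ∫ y in cube k R, d t * G (Fin.cons (T t) y) * ∑ i, y i ^ 2 = d t * g2 (T t) := by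
        rw [hg2, ← integral_const_mul]
        congr 1; ext y; ring
      rw [e1, e2] at this
      have e3 : (↑N - ↑k) * ((((N : ℝ) - (k + 1 : ℕ)) * c + d t) / (N - k)) * h t =
          (N - (k + 1 : ℕ)) * c * h t + d t * h t := by
        field_simp
      have e4 : d t = d t ^ (1 / (N : ℝ)) * d t ^ (1 - 1 / (N : ℝ)) := by
        rw [← Real.rpow_add (pd t)]; simp
      calc N * c ^ (((N : ℝ) - (k + 1 : ℕ)) / N) * (g1 (T t) * d t)
          = N * (c ^ (((N : ℝ) - (k + 1 : ℕ)) / N) * d t ^ (1 / (N : ℝ))) *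
              (d t ^ (1 - 1 / (N : ℝ)) * g1 (T t)) := by
            conv_lhs => rw [e4]
            ring
        _ ≤ N * ((((N : ℝ) - (k + 1 : ℕ)) * c + d t) / (N - k)) ^ (((N : ℝ) - k) / N) *
              (d t ^ (1 - 1 / (N : ℝ)) * g1 (T t)) := by
            have := rpow_interpolate hk hc (pd t)
            have : 0 < g1 (T t) := pI cG1 (fun x => Real.rpow_pos_of_pos (pG x) _) _
            have := Real.rpow_pos_of_pos (pd t) (1 - 1 / (N : ℝ))
            gcongr
        _ ≤ _ := this
        _ = _ := by rw [e3]; ring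
    have ii : ∀ {f : ℝ → ℝ}, Continuous f → IntervalIntegrable f volume (-R) R := fun hf =>
      hf.intervalIntegrable _ _
    have subst : ∀ {φ : ℝ → ℝ}, Continuous φ →
        ∫ t in (-R)..R, φ (T t) * d t = ∫ s in (-R)..R, φ s := fun {φ} hφ => by
      have := intervalIntegral.integral_comp_mul_deriv (a := -R) (b := R) (f := T) (f' := d)
        (fun x _ => dT x) cd.continuousOn hφ
      rw [T1, T2] at this
      exact this
    have dh : ∀ t, HasDerivAt h (h' t) t := fun t => by
      refine hasDerivAt_setIntegral_cube cH (cD 0) (fun s y => ?_) t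
      simpa using! hD 0 (Fin.cons s y)
    have bd : ∀ t, |t| = R → h t ≤ η * (2 * R) ^ k := fun t ht => by
      have h1 : h t ≤ ∫ y in cube k R, η :=
        setIntegral_mono_on (integrableOn_cube (cs cH t))
          (integrableOn_const (isCompact_cube k R).measure_lt_top.ne) (measurableSet_cube k R)
          fun y hy => by
            refine hb _ ?_ 0 (by simpa using ht)
            rw [mem_cube] at hy ⊢
            intro j
            refine Fin.cases ?_ (fun j => ?_) j
            · simpa [← abs_le] using ht.le
            · simpa using hy j
      simpa [volume_real_cube hR, mul_comm] using h1
    have parts : ∫ t in (-R)..R, d t * h t ≤ η * (2 * R) ^ (k + 1) + l / 2 * (∫ t in (-R)..R, q0 t) +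
        1 / (2 * l) * ∫ t in (-R)..R, t ^ 2 * Gm t := by
      have h1 := intervalIntegral.integral_mul_deriv_eq_deriv_mul (u := h) (u' := h') (v := T)
        (v' := d) (a := -R) (b := R) (fun x _ => dh x) (fun x _ => dT x) (ii ch') (ii cd)
      rw [T1, T2] at h1
      have h2 : ∫ t in (-R)..R, d t * h t = ∫ t in (-R)..R, h t * d t := by
        congr 1; ext t; ring
      have h3 : ∫ t in (-R)..R, -(h' t * T t) ≤
          ∫ t in (-R)..R, (l / 2 * q0 t + 1 / (2 * l) * ((T t ^ 2 * Gm (T t)) * d t)) := by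
        refine intervalIntegral.integral_mono_on hRR (ii (by fun_prop)) (ii (by fun_prop)) ?_
        intro t ht
        have h4 : (T t ^ 2 * Gm (T t)) * d t = T t ^ 2 * Fm t := by
          simp only [hFm, hT t ht]; ring
        rw [h4]
        simp only [hh', hq0, hFm]
        rw [← integral_mul_const, ← integral_neg, ← integral_const_mul, ← integral_const_mul,
          ← integral_const_mul, ← integral_add]
        · refine setIntegral_mono_on (integrableOn_cube ((cs (cD 0) t).mul_const _).neg)
            (integrableOn_cube ?_) (measurableSet_cube k R) fun y hy => ?_
          · exact ((cs cQ0 t).const_mul _).add (((cs cF t).const_mul _).const_mul _)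
          · have hF := pF (Fin.cons t y)
            set A := F (Fin.cons t y)
            set B := D 0 (Fin.cons t y)
            have : l / 2 * (B ^ 2 / A) + 1 / (2 * l) * (T t ^ 2 * A) - -(B * T t) =
              (l * B + T t * A) ^ 2 / (2 * l * A) := by
                field_simp; ring
            have h5 : 0 ≤ (l * B + T t * A) ^ 2 / (2 * l * A) := by positivity
            linarith
        · exact integrableOn_cube ((cs cQ0 t).const_mul _)
        · exact integrableOn_cube (((cs cF t).const_mul _).const_mul _)
      rw [intervalIntegral.integral_neg, intervalIntegral.integral_add (ii (by fun_prop))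
        (ii (by fun_prop)), intervalIntegral.integral_const_mul,
        intervalIntegral.integral_const_mul, subst (φ := fun s => s ^ 2 * Gm s) (by fun_prop)] at h3
      have b1 := bd R (abs_of_pos hR)
      have b2 := bd (-R) (by rw [abs_neg, abs_of_pos hR])
      have : h R * R + h (-R) * R ≤ η * (2 * R) ^ (k + 1) := by
        rw [pow_succ]
        nlinarith
      rw [h2]
      linarith
    have total := intervalIntegral.integral_mono_on hRR (ii (by fun_prop)) (ii (by fun_prop)) slice
    rw [intervalIntegral.integral_const_mul, subst cg1,
      intervalIntegral.integral_add (ii (by fun_prop)) (ii (by fun_prop)),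
      intervalIntegral.integral_add (ii (by fun_prop)) (ii (by fun_prop)),
      intervalIntegral.integral_add (ii (by fun_prop)) (ii (by fun_prop)),
      intervalIntegral.integral_add (ii (by fun_prop)) (ii (by fun_prop)),
      intervalIntegral.integral_const_mul, intervalIntegral.integral_const_mul,
      intervalIntegral.integral_const_mul, subst cg2, intervalIntegral.integral_const,
      smul_eq_mul] at total
    have cDF : Continuous fun x => (∑ i, D i x ^ 2) / F x :=
      (continuous_finsetSum _ fun i _ => (cD _).pow 2).div cF fun x => (pF x).ne'
    have eD : ∫ x in cube (k + 1) R, (∑ i, D i x ^ 2) / F x =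
        (∫ t in (-R)..R, q0 t) + ∫ t in (-R)..R, q t := by
      rw [setIntegral_cube_succ hR cDF, ← intervalIntegral.integral_add (ii cq0) (ii cq)]
      congr 1; ext t
      simp only [hq0, hq]
      rw [← integral_add (integrableOn_cube (cs cQ0 t)) (integrableOn_cube (cs cQ t))]
      congr 1; ext y
      rw [Fin.sum_univ_succ, add_div]
    have eG : ∫ x in cube (k + 1) R, G x * ∑ i, x i ^ 2 =
        (∫ t in (-R)..R, t ^ 2 * Gm t) + ∫ t in (-R)..R, g2 t := by
      rw [setIntegral_cube_succ hR (by fun_prop),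
        ← intervalIntegral.integral_add (ii (by fun_prop)) (ii cg2)]
      congr 1; ext t
      simp only [hg2, hGm]
      have c3 : Continuous fun y : Fin k → ℝ => G (Fin.cons t y) * ∑ i, y i ^ 2 :=
        (cs cG t).mul (by fun_prop)
      rw [← integral_const_mul, ← integral_add (integrableOn_cube ((cs cG t).const_mul _))
        (integrableOn_cube c3)]
      congr 1; ext y
      rw [Fin.sum_univ_succ]
      simp only [Fin.cons_zero, Fin.cons_succ]
      ring
    rw [setIntegral_cube_succ hR cG1, setIntegral_cube_succ hR cH, eD, eG]
    have e5 : (R - -R) * (k * (η * (2 * R) ^ k)) = k * (η * (2 * R) ^ (k + 1)) := by ring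
    rw [e5] at total
    calc _ ≤ _ := total
      _ ≤ _ := by push_cast; linarith

theorem lintegral_rpow_mul_exp_neg_mul_Ioi {a r : ℝ} (ha : 0 < a) (hr : 0 < r) :
    ∫⁻ t in Ioi (0 : ℝ), ENNReal.ofReal (t ^ (a - 1) * rexp (-(r * t))) =
      ENNReal.ofReal ((1 / r) ^ a * Gamma a) := by
  have hval := Real.integral_rpow_mul_exp_neg_mul_Ioi ha hr
  have hint : IntegrableOn (fun t : ℝ => t ^ (a - 1) * rexp (-(r * t))) (Ioi 0) := by
    by_contra h
    rw [integral_undef h] at hval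
    have : 0 < (1 / r) ^ a * Gamma a := by have := Gamma_pos_of_pos ha; positivity
    exact this.ne hval
  rw [← hval, ofReal_integral_eq_lintegral_ofReal hint]
  filter_upwards [ae_restrict_mem measurableSet_Ioi] with t ht
  have : (0 : ℝ) < t := ht
  positivity

theorem integral_one_add_norm_sq_rpow_neg {n : ℕ} {s : ℝ} (hs : (n : ℝ) / 2 < s) :
    ∫ y : EuclideanSpace ℝ (Fin n), (1 + ‖y‖ ^ 2) ^ (-s) =
      π ^ ((n : ℝ) / 2) * Gamma (s - n / 2) / Gamma s := by
  have hs0 : 0 < s := lt_of_le_of_lt (by positivity) hs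
  have hΓ := Gamma_pos_of_pos hs0
  have hΓ' := Gamma_pos_of_pos (sub_pos.2 hs)
  have hw : ∀ y : EuclideanSpace ℝ (Fin n), 0 < 1 + ‖y‖ ^ 2 := fun y => by positivity
  rw [integral_eq_lintegral_of_nonneg_ae (Eventually.of_forall fun y => by positivity)
    (by
      refine Continuous.aestronglyMeasurable ?_
      exact (by fun_prop : Continuous fun y : EuclideanSpace ℝ (Fin n) => 1 + ‖y‖ ^ 2).rpow_const
        fun y => Or.inl (hw y).ne')]
  have h1 : ∀ y : EuclideanSpace ℝ (Fin n), ENNReal.ofReal ((1 + ‖y‖ ^ 2) ^ (-s)) =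
      ENNReal.ofReal (1 / Gamma s) *
        ∫⁻ t in Ioi (0 : ℝ), ENNReal.ofReal (t ^ (s - 1) * rexp (-((1 + ‖y‖ ^ 2) * t))) := fun y => by
    rw [lintegral_rpow_mul_exp_neg_mul_Ioi hs0 (hw y), ← ENNReal.ofReal_mul (by positivity)]
    congr 1
    rw [one_div (1 + ‖y‖ ^ 2), Real.inv_rpow (hw y).le, Real.rpow_neg (hw y).le]
    field_simp
  simp_rw [h1]
  rw [lintegral_const_mul' _ _ ENNReal.ofReal_ne_top, lintegral_lintegral_swap]
  swap
  · refine (ENNReal.measurable_ofReal.comp ?_).aemeasurable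
    fun_prop
  have h2 : ∀ t ∈ Ioi (0 : ℝ), ∫⁻ y : EuclideanSpace ℝ (Fin n),
      ENNReal.ofReal (t ^ (s - 1) * rexp (-((1 + ‖y‖ ^ 2) * t))) =
      ENNReal.ofReal (π ^ ((n : ℝ) / 2)) *
        ENNReal.ofReal (t ^ ((s - n / 2) - 1) * rexp (-(1 * t))) := fun t ht => by
    have ht : 0 < t := ht
    have hg := GaussianFourier.integral_rexp_neg_mul_sq_norm (V := EuclideanSpace ℝ (Fin n)) ht
    rw [finrank_euclideanSpace_fin] at hg
    have hgi : Integrable fun y : EuclideanSpace ℝ (Fin n) => rexp (-t * ‖y‖ ^ 2) := by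
      by_contra h
      rw [integral_undef h] at hg
      have : 0 < (π / t) ^ ((n : ℝ) / 2) := by have := pi_pos; positivity
      exact this.ne hg
    have h3 : ∀ y : EuclideanSpace ℝ (Fin n),
        ENNReal.ofReal (t ^ (s - 1) * rexp (-((1 + ‖y‖ ^ 2) * t))) =
        ENNReal.ofReal (t ^ (s - 1) * rexp (-t)) * ENNReal.ofReal (rexp (-t * ‖y‖ ^ 2)) := fun y => by
      rw [← ENNReal.ofReal_mul (by positivity), mul_assoc, ← Real.exp_add]
      congr 3; ring
    simp_rw [h3]
    rw [lintegral_const_mul' _ _ ENNReal.ofReal_ne_top, ← ofReal_integral_eq_lintegral_ofReal hgi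
      (Eventually.of_forall fun y => (Real.exp_pos _).le), hg, ← ENNReal.ofReal_mul (by positivity),
      ← ENNReal.ofReal_mul (by positivity)]
    congr 1
    rw [Real.div_rpow pi_pos.le ht.le, one_mul,
      show s - n / 2 - 1 = (s - 1) - n / 2 by ring, Real.rpow_sub ht (s - 1)]
    ring
  rw [setLIntegral_congr_fun measurableSet_Ioi h2, lintegral_const_mul' _ _ ENNReal.ofReal_ne_top,
    lintegral_rpow_mul_exp_neg_mul_Ioi (sub_pos.2 hs) one_pos, ← ENNReal.ofReal_mul (by positivity),
    ← ENNReal.ofReal_mul (by positivity), ENNReal.toReal_ofReal (by positivity), div_one, one_rpow]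
  ring

theorem integrable_one_add_sum_sq_rpow_neg {n : ℕ} {s : ℝ} (hs : (n : ℝ) / 2 < s) :
    Integrable fun y : Fin n → ℝ => (1 + ∑ i, y i ^ 2) ^ (-s) := by
  have h := integrable_rpow_neg_one_add_norm_sq (E := EuclideanSpace ℝ (Fin n)) (μ := volume)
    (r := 2 * s) (by rw [finrank_euclideanSpace_fin]; linarith)
  rw [← (PiLp.volume_preserving_toLp (Fin n)).integrable_comp_emb
    (MeasurableEquiv.toLp 2 (Fin n → ℝ)).measurableEmbedding] at h
  refine h.congr (Eventually.of_forall fun y => ?_)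
  simp [EuclideanSpace.norm_sq_eq, neg_div]

theorem integral_one_add_sum_sq_rpow_neg {n : ℕ} {s : ℝ} (hs : (n : ℝ) / 2 < s) :
    ∫ y : Fin n → ℝ, (1 + ∑ i, y i ^ 2) ^ (-s) =
      π ^ ((n : ℝ) / 2) * Gamma (s - n / 2) / Gamma s := by
  rw [← integral_one_add_norm_sq_rpow_neg hs,
    ← (PiLp.volume_preserving_toLp (Fin n)).integral_comp
      (MeasurableEquiv.toLp 2 (Fin n → ℝ)).measurableEmbedding]
  simp [EuclideanSpace.norm_sq_eq]

theorem tendsto_setIntegral_cube {n : ℕ} {f : (Fin n → ℝ) → ℝ} (hf : Integrable f) :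
    Tendsto (fun R => ∫ x in cube n R, f x) atTop (𝓝 (∫ x, f x)) := by
  refine AECover.integral_tendsto_of_countably_generated (φ := fun R => cube n R) ⟨?_, ?_⟩ hf
  · refine Eventually.of_forall fun x => ?_
    filter_upwards [eventually_ge_atTop ‖x‖] with R hR
    rw [mem_cube]
    intro i
    exact abs_le.1 ((norm_le_pi_norm x i).trans hR)
  · exact fun R => measurableSet_cube n R

/-- The transport inequality on a cube, with a bubble as target density. -/
theorem sobolev_cube_approx {n : ℕ} (hn : 3 ≤ n) {R l δ : ℝ} (hR : 0 < R) (hl : 0 < l) (hδ : 0 < δ)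
    {f : (Fin n → ℝ) → ℝ} {P : Fin n → (Fin n → ℝ) → ℝ} (cf : Continuous f)
    (cP : ∀ i, Continuous (P i))
    (hP : ∀ i x, HasDerivAt (fun t => f (Function.update x i t)) (P i x) (x i))
    (hb : ∀ x ∈ cube n R, ∀ i, |x i| = R → f x = 0) {B κ : ℝ}
    (hB : B = ∫ y in cube n R, (1 + ∑ i, y i ^ 2) ^ (-(n : ℝ)))
    (hκ : κ = ((∫ x in cube n R, |f x| ^ (2 * (n : ℝ) / (n - 2))) + δ * (2 * R) ^ n) / B) :
    n * κ ^ (1 - 1 / (n : ℝ)) * ∫ y in cube n R, (1 + ∑ i, y i ^ 2) ^ (-((n : ℝ) - 1)) ≤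
      l / 2 * ((2 * (n - 1) / (n - 2)) ^ 2 * ∫ x in cube n R, ∑ i, P i x ^ 2) +
      1 / (2 * l) * (κ * ∫ y in cube n R, (1 + ∑ i, y i ^ 2) ^ (-(n : ℝ)) * ∑ i, y i ^ 2) +
      n * (δ ^ (1 - 1 / (n : ℝ)) * (2 * R) ^ n) := by
  have hn' : (3 : ℝ) ≤ n := by exact_mod_cast hn
  have hn2 : (0 : ℝ) < n - 2 := by linarith
  have hn0 : (0 : ℝ) < n := by linarith
  set p : ℝ := 2 * (n : ℝ) / (n - 2) with hp
  have hp2 : 2 < p := by rw [hp, lt_div_iff₀ hn2]; linarith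
  have hw : ∀ y : Fin n → ℝ, 0 < 1 + ∑ i, y i ^ 2 := fun y => by positivity
  have cw : ∀ s : ℝ, Continuous fun y : Fin n → ℝ => (1 + ∑ i, y i ^ 2) ^ s := fun s =>
    (by fun_prop : Continuous fun y : Fin n → ℝ => 1 + ∑ i, y i ^ 2).rpow_const
      fun y => Or.inl (hw y).ne'
  have cfp : Continuous fun x => |f x| ^ p := cf.abs.rpow_const fun x => Or.inr (by linarith)
  have Bpos : 0 < B := by
    obtain ⟨z, -, hz⟩ := (isCompact_cube n R).exists_isMinOn ⟨0, by simp [mem_cube, hR.le]⟩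
      (cw (-(n : ℝ))).continuousOn
    have h1 : ∫ y in cube n R, (1 + ∑ i, z i ^ 2) ^ (-(n : ℝ)) ≤ B := by
      rw [hB]
      exact setIntegral_mono_on (integrableOn_const (isCompact_cube n R).measure_lt_top.ne)
        (integrableOn_cube (cw _)) (measurableSet_cube n R) fun y hy => hz hy
    refine lt_of_lt_of_le ?_ h1
    simp only [setIntegral_const, volume_real_cube hR, smul_eq_mul]
    have := hw z
    positivity
  have hM : 0 ≤ ∫ x in cube n R, |f x| ^ p := integral_nonneg fun x => by positivity
  have κpos : 0 < κ := by rw [hκ]; positivity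
  set F : (Fin n → ℝ) → ℝ := fun x => |f x| ^ p + δ with hF
  have pF : ∀ x, 0 < F x := fun x => by positivity
  set D : Fin n → (Fin n → ℝ) → ℝ := fun i x =>
    p * |f x| ^ (p - 2) * f x * P i x * (1 - 1 / (n : ℝ)) * F x ^ (1 - 1 / (n : ℝ) - 1) with hD
  have cF : Continuous F := cfp.add_const _
  have key := cube_transport_inequality (N := n) (R := R) (η := δ ^ (1 - 1 / (n : ℝ))) (l := l)
    hR hl n le_rfl F (fun y => κ * (1 + ∑ i, y i ^ 2) ^ (-(n : ℝ)))
    (fun x => F x ^ (1 - 1 / (n : ℝ))) D 1 one_pos cF ((cw _).const_mul _) pF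
    (fun y => mul_pos κpos (Real.rpow_pos_of_pos (hw y) _)) (fun _ => rfl)
    (fun i => by
      have c1 : Continuous fun x => |f x| ^ (p - 2) :=
        cf.abs.rpow_const fun x => Or.inr (by linarith)
      have c2 : Continuous fun x => F x ^ (1 - 1 / (n : ℝ) - 1) :=
        cF.rpow_const fun x => Or.inl (pF x).ne'
      have := cP i
      simp only [hD]
      fun_prop)
    (fun i x => by
      have h1 := hP i x
      have h2 := hasDerivAt_abs_rpow (f (Function.update x i (x i))) (p := p) (by linarith)
      have h3 := ((h2.comp (x i) h1).add_const δ).rpow_const (p := 1 - 1 / (n : ℝ))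
        (Or.inl (by simpa using (pF x).ne'))
      simp only [Function.comp_def, Function.update_eq_self] at h3
      simp only [hF, hD]
      convert h3 using 1)
    (fun x hx i hi => by
      have : F x = δ := by simp [hF, hb x hx i hi, (by linarith : p ≠ 0)]
      simp only [this]; exact le_rfl)
    (by
      rw [integral_const_mul, ← hB, hκ, div_mul_cancel₀ _ Bpos.ne']
      simp only [hF]
      rw [integral_add (integrableOn_cube cfp)
        (integrableOn_const (isCompact_cube n R).measure_lt_top.ne)]
      simp [volume_real_cube hR, mul_comm])
  have e1 : ∫ y in cube n R, (κ * (1 + ∑ i, y i ^ 2) ^ (-(n : ℝ))) ^ (1 - 1 / (n : ℝ)) =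
      κ ^ (1 - 1 / (n : ℝ)) * ∫ y in cube n R, (1 + ∑ i, y i ^ 2) ^ (-((n : ℝ) - 1)) := by
    rw [← integral_const_mul]
    congr 1; ext y
    rw [Real.mul_rpow κpos.le (Real.rpow_nonneg (hw y).le _), ← Real.rpow_mul (hw y).le]
    congr 2; field_simp
  have e2 : ∫ y in cube n R, κ * (1 + ∑ i, y i ^ 2) ^ (-(n : ℝ)) * ∑ i, y i ^ 2 =
      κ * ∫ y in cube n R, (1 + ∑ i, y i ^ 2) ^ (-(n : ℝ)) * ∑ i, y i ^ 2 := by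
    rw [← integral_const_mul]
    congr 1; ext y; ring
  have e3 : ∫ x in cube n R, (∑ i, D i x ^ 2) / F x ≤
      (2 * (n - 1) / (n - 2)) ^ 2 * ∫ x in cube n R, ∑ i, P i x ^ 2 := by
    rw [← integral_const_mul]
    have c2 : Continuous fun x => F x ^ (1 - 1 / (n : ℝ) - 1) :=
      cF.rpow_const fun x => Or.inl (pF x).ne'
    have c1 : Continuous fun x => |f x| ^ (p - 2) :=
        cf.abs.rpow_const fun x => Or.inr (by linarith)
    refine setIntegral_mono_on (integrableOn_cube ?_) (integrableOn_cube (by fun_prop))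
      (measurableSet_cube n R) fun x _ => ?_
    · simp only [hD]
      exact Continuous.div (by fun_prop) cF fun x => (pF x).ne'
    · have h4 : (∑ i, D i x ^ 2) / F x = (2 * (n - 1) / (n - 2)) ^ 2 *
          ((|f x| ^ (p - 2) * f x) ^ 2 * (F x ^ (1 - 1 / (n : ℝ) - 1)) ^ 2 / F x) *
            ∑ i, P i x ^ 2 := by
        rw [Finset.mul_sum, Finset.sum_div]
        refine Finset.sum_congr rfl fun i _ => ?_
        simp only [hD, hp]
        field_simp
      rw [h4]
      have h5 : (|f x| ^ (p - 2) * f x) ^ 2 * (F x ^ (1 - 1 / (n : ℝ) - 1)) ^ 2 / F x ≤ 1 := by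
        rw [div_le_one (pF x)]
        rcases eq_or_ne (f x) 0 with h0 | h0
        · simp [h0, (pF x).le]
        have ha : 0 < |f x| := abs_pos.2 h0
        have h6 : (|f x| ^ (p - 2) * f x) ^ 2 = (|f x| ^ p) ^ (1 + 2 / (n : ℝ)) := by
          rw [mul_pow, ← sq_abs (f x), ← Real.rpow_natCast, ← Real.rpow_natCast |f x|,
            ← Real.rpow_mul ha.le, ← Real.rpow_mul ha.le, ← Real.rpow_add ha]
          congr 1
          rw [hp]; field_simp; push_cast; ring
        have h7 : (F x ^ (1 - 1 / (n : ℝ) - 1)) ^ 2 = F x ^ (-(2 / (n : ℝ))) := by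
          rw [← Real.rpow_natCast, ← Real.rpow_mul (pF x).le]
          congr 1; push_cast; ring
        calc _ ≤ F x ^ (1 + 2 / (n : ℝ)) * F x ^ (-(2 / (n : ℝ))) := by
              rw [h6, h7]
              have h8 : |f x| ^ p ≤ F x := by simp [hF, hδ.le]
              have := pF x
              gcongr
          _ = F x := by rw [← Real.rpow_add (pF x)]; simp
      have h9 : 0 ≤ ∑ i, P i x ^ 2 := by positivity
      have h10 : (0 : ℝ) ≤ (2 * (n - 1) / (n - 2)) ^ 2 := by positivity
      exact mul_le_mul_of_nonneg_right (by nlinarith) h9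
  rw [e1, e2] at key
  simp only [sub_self, zero_mul, zero_add, Real.one_rpow, mul_one] at key
  calc _ = _ := by ring
    _ ≤ _ := key
    _ ≤ _ := by gcongr

theorem sobolev_cube {n : ℕ} (hn : 3 ≤ n) {R l : ℝ} (hR : 0 < R) (hl : 0 < l)
    {f : (Fin n → ℝ) → ℝ} {P : Fin n → (Fin n → ℝ) → ℝ} (cf : Continuous f)
    (cP : ∀ i, Continuous (P i))
    (hP : ∀ i x, HasDerivAt (fun t => f (Function.update x i t)) (P i x) (x i))
    (hb : ∀ x ∈ cube n R, ∀ i, |x i| = R → f x = 0) {κ : ℝ}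
    (hκ : κ = (∫ x in cube n R, |f x| ^ (2 * (n : ℝ) / (n - 2))) /
      ∫ y in cube n R, (1 + ∑ i, y i ^ 2) ^ (-(n : ℝ))) :
    n * κ ^ (1 - 1 / (n : ℝ)) * ∫ y in cube n R, (1 + ∑ i, y i ^ 2) ^ (-((n : ℝ) - 1)) ≤
      l / 2 * ((2 * (n - 1) / (n - 2)) ^ 2 * ∫ x in cube n R, ∑ i, P i x ^ 2) +
      1 / (2 * l) * (κ * ∫ y in cube n R, (1 + ∑ i, y i ^ 2) ^ (-(n : ℝ)) * ∑ i, y i ^ 2) := by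
  have hn' : (3 : ℝ) ≤ n := by exact_mod_cast hn
  have he : 0 < 1 - 1 / (n : ℝ) := by
    rw [sub_pos, div_lt_one (by linarith)]; linarith
  set B := ∫ y in cube n R, (1 + ∑ i, y i ^ 2) ^ (-(n : ℝ)) with hB
  set M := ∫ x in cube n R, |f x| ^ (2 * (n : ℝ) / (n - 2)) with hM
  set B1 := ∫ y in cube n R, (1 + ∑ i, y i ^ 2) ^ (-((n : ℝ) - 1))
  set B2 := ∫ y in cube n R, (1 + ∑ i, y i ^ 2) ^ (-(n : ℝ)) * ∑ i, y i ^ 2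
  set E := ∫ x in cube n R, ∑ i, P i x ^ 2
  have tκ : Tendsto (fun δ : ℝ => (M + δ * (2 * R) ^ n) / B) (𝓝[>] 0) (𝓝 κ) := by
    have : Continuous fun δ : ℝ => (M + δ * (2 * R) ^ n) / B := by fun_prop
    have := this.tendsto 0
    rw [hκ]
    simp only [zero_mul, add_zero] at this
    exact this.mono_left nhdsWithin_le_nhds
  have tδ : Tendsto (fun δ : ℝ => δ ^ (1 - 1 / (n : ℝ))) (𝓝[>] 0) (𝓝 0) := by
    have := (Real.continuous_rpow_const he.le).tendsto 0
    rw [Real.zero_rpow he.ne'] at this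
    exact this.mono_left nhdsWithin_le_nhds
  have t1 := ((tκ.rpow_const (Or.inr he.le)).const_mul (n : ℝ)).mul_const B1
  have t2 := (((tκ.mul_const B2).const_mul (1 / (2 * l))).const_add
    (l / 2 * ((2 * (n - 1) / (n - 2)) ^ 2 * E))).add
    ((tδ.mul_const ((2 * R) ^ n)).const_mul (n : ℝ))
  simp only [zero_mul, mul_zero, add_zero] at t2
  refine le_of_tendsto_of_tendsto t1 t2 ?_
  filter_upwards [self_mem_nhdsWithin] with δ hδ
  exact sobolev_cube_approx hn hR hl hδ cf cP hP hb hB rfl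

/-- The sharp Sobolev inequality before optimizing in `l`. -/
theorem sobolev_parameter {n : ℕ} (hn : 3 ≤ n) {R₀ l : ℝ} (hl : 0 < l)
    {f : (Fin n → ℝ) → ℝ} {P : Fin n → (Fin n → ℝ) → ℝ} (cf : Continuous f)
    (cP : ∀ i, Continuous (P i))
    (hP : ∀ i x, HasDerivAt (fun t => f (Function.update x i t)) (P i x) (x i))
    (hb : ∀ x, f x ≠ 0 → x ∈ cube n R₀) (hbP : ∀ i x, P i x ≠ 0 → x ∈ cube n R₀) {κ B : ℝ}
    (hB : B = π ^ ((n : ℝ) / 2) * Gamma (n / 2) / Gamma n)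
    (hκ : κ = (∫ x, |f x| ^ (2 * (n : ℝ) / (n - 2))) / B) :
    n * κ ^ (1 - 1 / (n : ℝ)) * (2 * (n - 1) / (n - 2) * B) ≤
      l / 2 * ((2 * (n - 1) / (n - 2)) ^ 2 * ∫ x, ∑ i, P i x ^ 2) +
      1 / (2 * l) * (κ * (n / (n - 2) * B)) := by
  have hn' : (3 : ℝ) ≤ n := by exact_mod_cast hn
  have hn2 : (0 : ℝ) < n - 2 := by linarith
  have he : 0 < 1 - 1 / (n : ℝ) := by
    rw [sub_pos, div_lt_one (by linarith)]; linarith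
  have hG1 : 0 < Gamma ((n : ℝ) / 2) := Gamma_pos_of_pos (by linarith)
  have hG2 : 0 < Gamma (n : ℝ) := Gamma_pos_of_pos (by linarith)
  have hB0 : 0 < B := by have := pi_pos; rw [hB]; positivity
  have hw : ∀ y : Fin n → ℝ, 0 < 1 + ∑ i, y i ^ 2 := fun y => by positivity
  have i0 := integrable_one_add_sum_sq_rpow_neg (n := n) (s := n) (by linarith)
  have i1 := integrable_one_add_sum_sq_rpow_neg (n := n) (s := (n : ℝ) - 1) (by linarith)
  have v0 : ∫ y : Fin n → ℝ, (1 + ∑ i, y i ^ 2) ^ (-(n : ℝ)) = B := by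
    rw [integral_one_add_sum_sq_rpow_neg (by linarith), hB]
    congr 3; ring
  have v1 : ∫ y : Fin n → ℝ, (1 + ∑ i, y i ^ 2) ^ (-((n : ℝ) - 1)) =
      2 * (n - 1) / (n - 2) * B := by
    rw [integral_one_add_sum_sq_rpow_neg (by linarith), hB]
    have g1 : Gamma ((n : ℝ) / 2) = (n / 2 - 1) * Gamma (n / 2 - 1) := by
      rw [← Real.Gamma_add_one (by linarith)]; congr 1; ring
    have g2 : Gamma (n : ℝ) = (n - 1) * Gamma (n - 1) := by
      rw [← Real.Gamma_add_one (by linarith)]; congr 1; ring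
    have h3 : 0 < Gamma ((n : ℝ) - 1) := Gamma_pos_of_pos (by linarith)
    have h4 : (0 : ℝ) < n - 1 := by linarith
    rw [g1, g2, show (n : ℝ) - 1 - n / 2 = n / 2 - 1 by ring]
    field_simp
  have e2 : ∀ y : Fin n → ℝ, (1 + ∑ i, y i ^ 2) ^ (-(n : ℝ)) * ∑ i, y i ^ 2 =
      (1 + ∑ i, y i ^ 2) ^ (-((n : ℝ) - 1)) - (1 + ∑ i, y i ^ 2) ^ (-(n : ℝ)) := fun y => by
    rw [show -((n : ℝ) - 1) = -n + 1 by ring, Real.rpow_add (hw y), Real.rpow_one]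
    ring
  have i2 : Integrable fun y : Fin n → ℝ => (1 + ∑ i, y i ^ 2) ^ (-(n : ℝ)) * ∑ i, y i ^ 2 := by
    simp_rw [e2]; exact i1.sub i0
  have v2 : ∫ y : Fin n → ℝ, (1 + ∑ i, y i ^ 2) ^ (-(n : ℝ)) * ∑ i, y i ^ 2 = n / (n - 2) * B := by
    simp_rw [e2]
    rw [integral_sub i1 i0, v0, v1]
    field_simp; ring
  have t0 := tendsto_setIntegral_cube i0
  have t1 := tendsto_setIntegral_cube i1
  have t2 := tendsto_setIntegral_cube i2
  rw [v0] at t0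
  rw [v1] at t1
  rw [v2] at t2
  have tκ := (tendsto_const_nhds (x := ∫ x, |f x| ^ (2 * (n : ℝ) / (n - 2)))).div t0 hB0.ne'
  rw [← hκ] at tκ
  refine le_of_tendsto_of_tendsto
    (((tκ.rpow_const (Or.inr he.le)).const_mul (n : ℝ)).mul t1)
    (((tκ.mul t2).const_mul (1 / (2 * l))).const_add _) ?_
  filter_upwards [eventually_gt_atTop R₀, eventually_gt_atTop 0] with R hR hR0
  have hsub : cube n R₀ ⊆ cube n R := fun x hx => by
    rw [mem_cube] at hx ⊢
    exact fun i => ⟨by linarith [(hx i).1], by linarith [(hx i).2]⟩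
  have m1 : ∫ x in cube n R, |f x| ^ (2 * (n : ℝ) / (n - 2)) =
      ∫ x, |f x| ^ (2 * (n : ℝ) / (n - 2)) := by
    refine setIntegral_eq_integral_of_forall_compl_eq_zero fun x hx => ?_
    have : f x = 0 := by by_contra h; exact hx (hsub (hb x h))
    rw [this, abs_zero, Real.zero_rpow]
    positivity
  have m2 : ∫ x in cube n R, ∑ i, P i x ^ 2 = ∫ x, ∑ i, P i x ^ 2 := by
    refine setIntegral_eq_integral_of_forall_compl_eq_zero fun x hx => ?_
    refine Finset.sum_eq_zero fun i _ => ?_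
    have : P i x = 0 := by by_contra h; exact hx (hsub (hbP i x h))
    simp [this]
  have := sobolev_cube hn hR0 hl cf cP hP (fun x _ i hi => by
    by_contra h
    have := abs_le.2 (mem_cube.1 (hb x h) i)
    linarith) rfl
  rw [m1, m2] at this
  exact this

theorem sobolev_pi {n : ℕ} (hn : 3 ≤ n) {R₀ : ℝ}
    {f : (Fin n → ℝ) → ℝ} {P : Fin n → (Fin n → ℝ) → ℝ} (cf : Continuous f)
    (cP : ∀ i, Continuous (P i))
    (hP : ∀ i x, HasDerivAt (fun t => f (Function.update x i t)) (P i x) (x i))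
    (hb : ∀ x, f x ≠ 0 → x ∈ cube n R₀) (hbP : ∀ i x, P i x ≠ 0 → x ∈ cube n R₀) :
    sobolevConst n * (∫ x, |f x| ^ (2 * (n : ℝ) / (n - 2))) ^ (((n : ℝ) - 2) / n) ≤
      ∫ x, ∑ i, P i x ^ 2 := by
  have hn' : (3 : ℝ) ≤ n := by exact_mod_cast hn
  have hn2 : (0 : ℝ) < n - 2 := by linarith
  have hn1 : (0 : ℝ) < n - 1 := by linarith
  have hn0 : (0 : ℝ) < n := by linarith
  have hG1 : 0 < Gamma ((n : ℝ) / 2) := Gamma_pos_of_pos (by linarith)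
  have hG2 : 0 < Gamma (n : ℝ) := Gamma_pos_of_pos (by linarith)
  have hπ := pi_pos
  set E := ∫ x, ∑ i, P i x ^ 2 with hE
  set M := ∫ x, |f x| ^ (2 * (n : ℝ) / (n - 2)) with hM
  have hE0 : 0 ≤ E := integral_nonneg fun x => by positivity
  have hM0 : 0 ≤ M := integral_nonneg fun x => by positivity
  rcases hM0.eq_or_lt with h0 | hMpos
  · rw [← h0, Real.zero_rpow (by positivity), mul_zero]; exact hE0
  set B := π ^ ((n : ℝ) / 2) * Gamma (n / 2) / Gamma n with hB
  have hBpos : 0 < B := by positivity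
  have hS : sobolevConst n = n * (n - 2) * B ^ (2 / (n : ℝ)) := by
    rw [sobolevConst, hB, mul_div_assoc, Real.mul_rpow (by positivity) (by positivity),
      ← Real.rpow_mul hπ.le, show (n : ℝ) / 2 * (2 / n) = 1 by field_simp, Real.rpow_one]
    ring
  set κ := M / B with hκ
  have κpos : 0 < κ := by positivity
  set l : ℝ := κ ^ (1 / (n : ℝ)) / (2 * (n - 1)) with hl
  have lpos : 0 < l := by positivity
  have key := sobolev_parameter hn lpos cf cP hP hb hbP hB hκ
  rw [← hE] at key
  have hκa : κ = κ ^ (1 / (n : ℝ)) * κ ^ (1 - 1 / (n : ℝ)) := by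
    rw [← Real.rpow_add κpos]; simp
  have hκb : κ ^ (1 - 1 / (n : ℝ)) = κ ^ (1 / (n : ℝ)) * κ ^ (1 - 2 / (n : ℝ)) := by
    rw [← Real.rpow_add κpos]; congr 1; ring
  have hM2 : B ^ (2 / (n : ℝ)) * M ^ (((n : ℝ) - 2) / n) = B * κ ^ (1 - 2 / (n : ℝ)) := by
    rw [hκ, Real.div_rpow hMpos.le hBpos.le, show ((n : ℝ) - 2) / n = 1 - 2 / n by field_simp,
      mul_div_assoc', eq_div_iff (by positivity)]
    have : B ^ (2 / (n : ℝ)) * B ^ (1 - 2 / (n : ℝ)) = B := by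
      rw [← Real.rpow_add hBpos]; simp
    linear_combination M ^ (1 - 2 / (n : ℝ)) * this
  rw [hS, mul_assoc, hM2]
  set a := κ ^ (1 / (n : ℝ)) with ha
  set c := κ ^ (1 - 2 / (n : ℝ)) with hc
  have apos : 0 < a := by positivity
  rw [hκb, hκa, hκb, hl] at key
  have e1 : (1 : ℝ) / (2 * (a / (2 * (n - 1)))) * (a * (a * c) * (n / (n - 2) * B)) =
      a * c * (n * (n - 1) / (n - 2)) * B := by field_simp
  have e2 : a / (2 * (n - 1)) / 2 * ((2 * (n - 1) / (n - 2)) ^ 2 * E) =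
      a * (n - 1) / (n - 2) ^ 2 * E := by field_simp
  rw [e1, e2] at key
  have e3 : a * (n - 1) / (n - 2) ^ 2 * (n * (n - 2) * (B * c)) ≤ a * (n - 1) / (n - 2) ^ 2 * E := by
    have : a * (n - 1) / (n - 2) ^ 2 * (n * (n - 2) * (B * c)) =
        n * (a * c) * (2 * (n - 1) / (n - 2) * B) - a * c * (n * (n - 1) / (n - 2)) * B := by
      field_simp; ring
    linarith
  exact le_of_mul_le_mul_left e3 (by positivity)

theorem norm_gradient_sq {n : ℕ} (v : EuclideanSpace ℝ (Fin n) → ℝ) (x : EuclideanSpace ℝ (Fin n)) :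
    ‖gradient v x‖ ^ 2 = ∑ i, (fderiv ℝ v x (EuclideanSpace.single i 1)) ^ 2 := by
  rw [EuclideanSpace.norm_sq_eq]
  refine Finset.sum_congr rfl fun i _ => ?_
  rw [← inner_gradient_left, EuclideanSpace.inner_single_right, Real.norm_eq_abs, sq_abs]
  simp

/-- The sharp Sobolev inequality for continuously differentiable functions of compact support. -/
theorem sobolev_euclideanSpace {n : ℕ} (hn : 3 ≤ n) {v : EuclideanSpace ℝ (Fin n) → ℝ}
    (hv : ContDiff ℝ 1 v) (hc : HasCompactSupport v) :
    sobolevConst n * (∫ x, |v x| ^ (2 * (n : ℝ) / (n - 2))) ^ (((n : ℝ) - 2) / n) ≤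
      ∫ x, ‖gradient v x‖ ^ 2 := by
  have hme := (MeasurableEquiv.toLp 2 (Fin n → ℝ)).measurableEmbedding
  have hmp := PiLp.volume_preserving_toLp (Fin n)
  rw [← hmp.integral_comp hme, ← hmp.integral_comp hme]
  simp_rw [norm_gradient_sq]
  obtain ⟨R₀, hR⟩ := (hc : IsCompact _).isBounded.exists_norm_le
  have hcube : ∀ x : Fin n → ℝ, WithLp.toLp 2 x ∈ tsupport v → x ∈ cube n R₀ := fun x hx => by
    rw [mem_cube]
    intro i
    rw [Set.mem_Icc, ← abs_le]
    have := PiLp.norm_apply_le (WithLp.toLp 2 x : EuclideanSpace ℝ (Fin n)) i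
    exact this.trans (hR _ hx)
  have cfd : Continuous (fderiv ℝ v) := hv.continuous_fderiv one_ne_zero
  refine sobolev_pi hn (f := fun x => v (WithLp.toLp 2 x))
    (P := fun i x => fderiv ℝ v (WithLp.toLp 2 x) (EuclideanSpace.single i 1))
    (hv.continuous.comp (PiLp.continuous_toLp 2 _))
    (fun i => (cfd.comp (PiLp.continuous_toLp 2 _)).clm_apply continuous_const)
    (fun i x => ?_) (fun x hx => hcube x (subset_tsupport _ hx))
    (fun i x hx => hcube x (tsupport_fderiv_subset ℝ (subset_tsupport _ fun h => hx (by simp [h]))))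
  have h1 := hasDerivAt_update x i (x i)
  have h2 := (PiLp.hasFDerivAt_toLp (𝕜 := ℝ) 2 (Function.update x i (x i))).comp_hasDerivAt _ h1
  have h3 := ((hv.differentiable one_ne_zero) _).hasFDerivAt.comp_hasDerivAt (x i) h2
  simp only [Function.comp_apply, Function.update_eq_self] at h3
  exact h3

/-- Integration by parts against a compactly supported function has no boundary term. -/
theorem integral_mul_fderiv_add_eq_zero {n : ℕ} {f g : EuclideanSpace ℝ (Fin n) → ℝ}
    (hf : ContDiff ℝ 1 f) (hg : ContDiff ℝ 1 g) (hc : HasCompactSupport g)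
    (e : EuclideanSpace ℝ (Fin n)) :
    Integrable (fun x => f x * fderiv ℝ g x e + fderiv ℝ f x e * g x) ∧
      ∫ x, (f x * fderiv ℝ g x e + fderiv ℝ f x e * g x) = 0 := by
  have c1 : Continuous fun x => fderiv ℝ f x e :=
    (hf.continuous_fderiv one_ne_zero).clm_apply continuous_const
  have c2 : Continuous fun x => fderiv ℝ g x e :=
    (hg.continuous_fderiv one_ne_zero).clm_apply continuous_const
  have i1 : Integrable fun x => fderiv ℝ f x e * g x :=
    (c1.mul hg.continuous).integrable_of_hasCompactSupport hc.mul_left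
  have i2 : Integrable fun x => f x * fderiv ℝ g x e :=
    (hf.continuous.mul c2).integrable_of_hasCompactSupport (hc.fderiv_apply ℝ e).mul_left
  have i3 : Integrable fun x => f x * g x :=
    (hf.continuous.mul hg.continuous).integrable_of_hasCompactSupport hc.mul_left
  refine ⟨i2.add i1, ?_⟩
  rw [integral_add i2 i1, integral_mul_fderiv_eq_neg_fderiv_mul_of_integrable i1 i2 i3
    (fun x _ => hf.differentiable one_ne_zero x) (fun x _ => hg.differentiable one_ne_zero x)]
  simp

theorem integral_norm_gradient_weight_mul_le {n : ℕ} (hn : 3 ≤ n) {b c : ℝ} (hb : 0 < b)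
    (hc : 0 < c) {u : EuclideanSpace ℝ (Fin n) → ℝ} (hu : ContDiff ℝ 1 u)
    (hcs : HasCompactSupport u) :
    ∫ x, ‖gradient (fun x => (‖x‖ ^ 2 + c) ^ (b / 2) * u x) x‖ ^ 2 ≤
      ∫ x, (‖x‖ ^ 2 + c) ^ b * ‖gradient u x‖ ^ 2 := by
  have hn' : (3 : ℝ) ≤ n := by exact_mod_cast hn
  have hρ : ∀ x : EuclideanSpace ℝ (Fin n), 0 < ‖x‖ ^ 2 + c := fun x => by positivity
  have sρ : ContDiff ℝ 1 fun x : EuclideanSpace ℝ (Fin n) => ‖x‖ ^ 2 + c :=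
    (contDiff_norm_sq ℝ).add contDiff_const
  have sw : ∀ s : ℝ, ContDiff ℝ 1 fun x : EuclideanSpace ℝ (Fin n) => (‖x‖ ^ 2 + c) ^ s :=
    fun s => sρ.rpow_const_of_ne fun x => (hρ x).ne'
  have dw : ∀ (s : ℝ) (x : EuclideanSpace ℝ (Fin n)) (i : Fin n),
      fderiv ℝ (fun x : EuclideanSpace ℝ (Fin n) => (‖x‖ ^ 2 + c) ^ s) x
        (EuclideanSpace.single i 1) = 2 * s * x i * (‖x‖ ^ 2 + c) ^ (s - 1) := fun s x i => by
    have h1 := ((hasStrictFDerivAt_norm_sq x).hasFDerivAt.add_const c).rpow_const (p := s)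
      (Or.inl (hρ x).ne')
    rw [h1.fderiv]
    simp [EuclideanSpace.inner_single_right]
    ring
  have sx : ∀ i, ContDiff ℝ 1 fun x : EuclideanSpace ℝ (Fin n) => x i := fun i => by fun_prop
  have dx : ∀ (x : EuclideanSpace ℝ (Fin n)) (i : Fin n),
      fderiv ℝ (fun x : EuclideanSpace ℝ (Fin n) => x i) x (EuclideanSpace.single i 1) = 1 :=
    fun x i => by
      rw [(PiLp.hasFDerivAt_apply (𝕜 := ℝ) 2 x i).fderiv]
      simp
  set V : Fin n → EuclideanSpace ℝ (Fin n) → ℝ := fun i x => b * (x i * (‖x‖ ^ 2 + c) ^ (b - 1))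
    with hV
  have sV : ∀ i, ContDiff ℝ 1 (V i) := fun i => contDiff_const.mul ((sx i).mul (sw _))
  have dV : ∀ x i, fderiv ℝ (V i) x (EuclideanSpace.single i 1) =
      b * (‖x‖ ^ 2 + c) ^ (b - 1) +
        2 * b * (b - 1) * x i ^ 2 * (‖x‖ ^ 2 + c) ^ (b - 2) := fun x i => by
    have h1 := (sx i).differentiable one_ne_zero x
    have h2 := (sw (b - 1)).differentiable one_ne_zero x
    rw [hV]
    simp only
    rw [fderiv_const_mul (h1.fun_mul h2), fderiv_fun_mul h1 h2]
    simp only [smul_add, add_apply, smul_apply, dx, dw,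
      smul_eq_mul]
    rw [show b - 1 - 1 = b - 2 by ring]
    ring
  have su2 : ContDiff ℝ 1 fun x => u x ^ 2 := hu.pow 2
  have cu2 : HasCompactSupport fun x => u x ^ 2 := by
    simp_rw [pow_two]; exact hcs.mul_left
  have du2 : ∀ x e, fderiv ℝ (fun x => u x ^ 2) x e = 2 * u x * fderiv ℝ u x e := fun x e => by
    rw [fderiv_fun_pow 2 (hu.differentiable one_ne_zero x)]
    simp
  have hparts := fun i => integral_mul_fderiv_add_eq_zero (sV i) su2 cu2 (EuclideanSpace.single i 1)
  have cfd : ∀ {g : EuclideanSpace ℝ (Fin n) → ℝ}, ContDiff ℝ 1 g →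
      Continuous fun x => ‖gradient g x‖ ^ 2 := fun hg => by
    simp_rw [norm_gradient_sq]
    exact continuous_finsetSum _ fun i _ =>
      ((hg.continuous_fderiv one_ne_zero).clm_apply continuous_const).pow 2
  have cgs : ∀ {g : EuclideanSpace ℝ (Fin n) → ℝ}, HasCompactSupport g →
      HasCompactSupport fun x => ‖gradient g x‖ ^ 2 := fun hg => by
    refine (hg.fderiv ℝ).mono fun x hx h => hx ?_
    simp [norm_gradient_sq, h]
  have i0 : Integrable fun x => ‖gradient (fun x => (‖x‖ ^ 2 + c) ^ (b / 2) * u x) x‖ ^ 2 :=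
    (cfd ((sw _).mul hu)).integrable_of_hasCompactSupport (cgs hcs.mul_left)
  have i1 : Integrable fun x => (‖x‖ ^ 2 + c) ^ b * ‖gradient u x‖ ^ 2 :=
    ((sw b).continuous.mul (cfd hu)).integrable_of_hasCompactSupport (cgs hcs).mul_left
  have i2 := integrable_finsetSum Finset.univ fun i _ => (hparts i).1
  have z2 := integral_finsetSum Finset.univ fun i _ => (hparts i).1
  simp only [(hparts _).2, Finset.sum_const_zero] at z2
  rw [← add_zero (∫ x, (‖x‖ ^ 2 + c) ^ b * ‖gradient u x‖ ^ 2), ← z2, ← integral_add i1 i2]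
  refine integral_mono i0 (i1.add i2) fun x => ?_
  simp only [norm_gradient_sq, Finset.mul_sum, ← Finset.sum_add_distrib]
  have hdv : ∀ i, fderiv ℝ (fun x => (‖x‖ ^ 2 + c) ^ (b / 2) * u x) x (EuclideanSpace.single i 1) =
      (‖x‖ ^ 2 + c) ^ (b / 2) * fderiv ℝ u x (EuclideanSpace.single i 1) +
        u x * (b * x i * (‖x‖ ^ 2 + c) ^ (b / 2 - 1)) := fun i => by
    rw [fderiv_fun_mul ((sw _).differentiable one_ne_zero x) (hu.differentiable one_ne_zero x)]
    simp only [add_apply, smul_apply, dw, smul_eq_mul]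
    ring
  simp only [hdv, dV, du2]
  set r := ‖x‖ ^ 2 + c with hr
  have r0 : 0 < r := hρ x
  set A := r ^ (b / 2 - 1) with hA
  have e1 : r ^ (b / 2) = r * A := by
    rw [hA, ← Real.rpow_one_add' r0.le (by linarith)]; congr 1; ring
  have e2 : r ^ b = r ^ 2 * A ^ 2 := by
    rw [← mul_pow, ← e1, ← Real.rpow_natCast, ← Real.rpow_mul r0.le]; congr 1; push_cast; ring
  have e3 : r ^ (b - 2) = A ^ 2 := by
    rw [hA, ← Real.rpow_natCast, ← Real.rpow_mul r0.le]; congr 1; push_cast; ring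
  have e4 : r ^ (b - 1) = r * A ^ 2 := by
    rw [← e3, show b - 1 = 1 + (b - 2) by ring, Real.rpow_add r0, Real.rpow_one]
  have hV' : ∀ i, V i x = b * (x i * (r * A ^ 2)) := fun i => by simp only [hV, ← hr, e4]
  simp only [hV', e1, e2, e3, e4]
  rw [← sub_nonneg, ← Finset.sum_sub_distrib]
  have hx : ∑ i, x i ^ 2 = ‖x‖ ^ 2 := by simp [EuclideanSpace.norm_sq_eq]
  calc (0 : ℝ) ≤ u x ^ 2 * A ^ 2 * b * (n * r + (b - 2) * ‖x‖ ^ 2) := by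
        have : 0 ≤ n * r + (b - 2) * ‖x‖ ^ 2 := by
          have := sq_nonneg ‖x‖
          rw [hr]
          nlinarith [mul_nonneg hb.le this, mul_nonneg (by linarith : (0 : ℝ) ≤ n - 3) this]
        positivity
    _ = ∑ i, u x ^ 2 * A ^ 2 * b * (r + (b - 2) * x i ^ 2) := by
        rw [← Finset.mul_sum, Finset.sum_add_distrib, ← Finset.mul_sum, hx]
        simp
    _ = _ := Finset.sum_congr rfl fun i _ => by ring

theorem ckn_regularized {n : ℕ} (hn : 3 ≤ n) {b c : ℝ} (hb : 0 < b)
    (hc : 0 < c) {u : EuclideanSpace ℝ (Fin n) → ℝ} (hu : ContDiff ℝ 1 u)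
    (hcs : HasCompactSupport u) :
    sobolevConst n *
        (∫ x, ‖x‖ ^ (2 * b * (n : ℝ) / (n - 2)) * |u x| ^ (2 * (n : ℝ) / (n - 2))) ^
          (((n : ℝ) - 2) / n) ≤
      ∫ x, (‖x‖ ^ 2 + c) ^ b * ‖gradient u x‖ ^ 2 := by
  have hn' : (3 : ℝ) ≤ n := by exact_mod_cast hn
  have hn2 : (0 : ℝ) < n - 2 := by linarith
  have hρ : ∀ x : EuclideanSpace ℝ (Fin n), 0 < ‖x‖ ^ 2 + c := fun x => by positivity
  have sw : ContDiff ℝ 1 fun x : EuclideanSpace ℝ (Fin n) => (‖x‖ ^ 2 + c) ^ (b / 2) :=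
    ((contDiff_norm_sq ℝ).add contDiff_const).rpow_const_of_ne fun x => (hρ x).ne'
  refine le_trans ?_ ((sobolev_euclideanSpace hn (sw.mul hu) hcs.mul_left).trans
    (integral_norm_gradient_weight_mul_le hn hb hc hu hcs))
  have hS : 0 ≤ sobolevConst n := by
    have := Gamma_pos_of_pos (by linarith : (0 : ℝ) < n / 2)
    have := Gamma_pos_of_pos (by linarith : (0 : ℝ) < n)
    rw [sobolevConst]
    have := pi_pos
    positivity
  have cp : ∀ {g : EuclideanSpace ℝ (Fin n) → ℝ}, HasCompactSupport g →
      HasCompactSupport fun x => |g x| ^ (2 * (n : ℝ) / (n - 2)) := fun hg => by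
    refine hg.mono fun x hx h => hx ?_
    have : 2 * (n : ℝ) / (n - 2) ≠ 0 := by positivity
    simp [h, this]
  have cc : ∀ {g : EuclideanSpace ℝ (Fin n) → ℝ}, Continuous g →
      Continuous fun x => |g x| ^ (2 * (n : ℝ) / (n - 2)) := fun hg =>
    hg.abs.rpow_const fun x => Or.inr (by positivity)
  refine mul_le_mul_of_nonneg_left (Real.rpow_le_rpow (integral_nonneg fun x => by positivity)
    (integral_mono ?_ ?_ fun x => ?_) (by positivity)) hS
  · exact ((continuous_norm.rpow_const fun x => Or.inr (by positivity)).mul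
      (cc hu.continuous)).integrable_of_hasCompactSupport (cp hcs).mul_left
  · exact (cc (sw.continuous.mul hu.continuous)).integrable_of_hasCompactSupport (cp hcs.mul_left)
  · simp only
    rw [abs_mul, abs_of_nonneg (Real.rpow_nonneg (hρ x).le _),
      Real.mul_rpow (Real.rpow_nonneg (hρ x).le _) (abs_nonneg _), ← Real.rpow_mul (hρ x).le]
    refine mul_le_mul_of_nonneg_right ?_ (by positivity)
    rw [show 2 * b * (n : ℝ) / (n - 2) = (2 : ℕ) * (b / 2 * (2 * n / (n - 2))) by push_cast; ring,
      Real.rpow_mul (norm_nonneg x), Real.rpow_natCast]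
    gcongr
    linarith

theorem tendsto_integral_weight_norm_gradient {n : ℕ} {b : ℝ} (hb : 0 < b)
    {u : EuclideanSpace ℝ (Fin n) → ℝ} (hu : ContDiff ℝ 1 u) (hcs : HasCompactSupport u) :
    Tendsto (fun c : ℝ => ∫ x, (‖x‖ ^ 2 + c) ^ b * ‖gradient u x‖ ^ 2) (𝓝[>] 0)
      (𝓝 (∫ x, ‖x‖ ^ (2 * b) * ‖gradient u x‖ ^ 2)) := by
  have cg : Continuous fun x => ‖gradient u x‖ ^ 2 := by
    simp_rw [norm_gradient_sq]
    exact continuous_finsetSum _ fun i _ =>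
      ((hu.continuous_fderiv one_ne_zero).clm_apply continuous_const).pow 2
  have sg : HasCompactSupport fun x => ‖gradient u x‖ ^ 2 := by
    refine (hcs.fderiv ℝ).mono fun x hx h => hx ?_
    simp [norm_gradient_sq, h]
  have cw : ∀ c : ℝ, Continuous fun x : EuclideanSpace ℝ (Fin n) =>
      (‖x‖ ^ 2 + c) ^ b * ‖gradient u x‖ ^ 2 := fun c =>
    ((by fun_prop : Continuous fun x : EuclideanSpace ℝ (Fin n) => ‖x‖ ^ 2 + c).rpow_const
      fun x => Or.inr hb.le).mul cg
  refine tendsto_integral_filter_of_dominated_convergence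
    (fun x => (‖x‖ ^ 2 + 1) ^ b * ‖gradient u x‖ ^ 2)
    (Eventually.of_forall fun c => (cw c).aestronglyMeasurable) ?_
    ((cw 1).integrable_of_hasCompactSupport sg.mul_left) (Eventually.of_forall fun x => ?_)
  · filter_upwards [self_mem_nhdsWithin, nhdsWithin_le_nhds (Iic_mem_nhds one_pos)] with c hc hc1
    refine Eventually.of_forall fun x => ?_
    have hc0 : (0 : ℝ) < c := hc
    have hc1' : c ≤ 1 := hc1
    rw [Real.norm_of_nonneg (by positivity)]
    gcongr
  · have h1 : ‖x‖ ^ (2 * b) = (‖x‖ ^ 2 + 0) ^ b := by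
      rw [add_zero, Real.rpow_mul (norm_nonneg x), Real.rpow_two]
    rw [h1]
    have : Continuous fun c : ℝ => (‖x‖ ^ 2 + c) ^ b * ‖gradient u x‖ ^ 2 :=
      ((continuous_const.add continuous_id).rpow_const fun c => Or.inr hb.le).mul continuous_const
    exact (this.tendsto 0).mono_left nhdsWithin_le_nhds

end CaffarelliKohnNirenberg

theorem stmt16 (n : ℕ) (hn : 3 ≤ n) (b : ℝ) (hb : 0 < b)
    (u : EuclideanSpace ℝ (Fin n) → ℝ) (hu : ContDiff ℝ (⊤ : ℕ∞) u) (hcs : HasCompactSupport u) :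
    (∫ x : EuclideanSpace ℝ (Fin n), ‖x‖ ^ (2 * b) * ‖gradient u x‖ ^ 2)
      ≥ sobolevConst n *
          (∫ x : EuclideanSpace ℝ (Fin n),
              ‖x‖ ^ (2 * b * (n : ℝ) / ((n : ℝ) - 2)) *
                |u x| ^ (2 * (n : ℝ) / ((n : ℝ) - 2)))
            ^ (((n : ℝ) - 2) / (n : ℝ)) := by
  have hu1 : ContDiff ℝ 1 u := hu.of_le (by exact_mod_cast le_top)
  refine ge_of_tendsto (tendsto_integral_weight_norm_gradient hb hu1 hcs) ?_
  filter_upwards [self_mem_nhdsWithin] with c hc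
  exact ckn_regularized hn hb hc hu1 hcs
end

section
/- Let n ≥ 3 and b > 0. The constant S_n in the Caffarelli–Kohn–Nirenberg inequality with weight |x|^{2b} is sharp: for every C > S_n there exists a nonzero u ∈ C_c^∞(ℝ^n) such that ∫_{ℝ^n} |x|^{2b} |∇u|² dx < C · ( ∫_{ℝ^n} |x|^{2bn/(n-2)} |u|^{2n/(n-2)} dx )^{(n-2)/n}. -/
open MeasureTheory Real

open Filter Topology Set

theorem integral_one_add_norm_sq_rpow_neg_s17 {V : Type*} [NormedAddCommGroup V]
    [InnerProductSpace ℝ V] [FiniteDimensional ℝ V] [MeasurableSpace V] [BorelSpace V]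
    {a : ℝ} (ha : (Module.finrank ℝ V : ℝ) / 2 < a) :
    ∫ x : V, (1 + ‖x‖ ^ 2) ^ (-a) = π ^ (Module.finrank ℝ V / 2 : ℝ) *
      Real.Gamma (a - Module.finrank ℝ V / 2) / Real.Gamma a := by
  set d : ℝ := (Module.finrank ℝ V : ℝ) with hd
  have hd0 : 0 ≤ d := Nat.cast_nonneg _
  have ha0 : 0 < a := lt_of_le_of_lt (by positivity) ha
  have hpos : ∀ x : V, 0 < 1 + ‖x‖ ^ 2 := fun x ↦ by positivity
  let f : V → ℝ → ℝ := fun x t ↦ t ^ (a - 1) * rexp (-((1 + ‖x‖ ^ 2) * t))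
  have hfx : ∀ x, ∫ t in Ioi (0 : ℝ), f x t = (1 + ‖x‖ ^ 2) ^ (-a) * Real.Gamma a := fun x ↦ by
    rw [Real.integral_rpow_mul_exp_neg_mul_Ioi ha0 (hpos x), one_div, Real.inv_rpow (hpos x).le,
      Real.rpow_neg (hpos x).le]
  have hft : ∀ t ∈ Ioi (0 : ℝ),
      ∫ x : V, f x t = π ^ (d / 2) * (t ^ (a - d / 2 - 1) * rexp (-(1 * t))) := fun t ht ↦ by
    have ht : 0 < t := ht
    have : ∀ x : V, f x t = (t ^ (a - 1) * rexp (-(1 * t))) * rexp (-t * ‖x‖ ^ 2) := fun x ↦ by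
      simp only [f]
      rw [mul_assoc, ← Real.exp_add]
      ring_nf
    simp_rw [this]
    rw [integral_const_mul, GaussianFourier.integral_rexp_neg_mul_sq_norm ht,
      Real.div_rpow pi_pos.le ht.le, show a - d / 2 - 1 = (a - 1) - d / 2 by ring,
      Real.rpow_sub ht (a - 1)]
    ring
  have hint : Integrable (Function.uncurry f)
      ((volume : Measure V).prod (volume.restrict (Ioi (0 : ℝ)))) := by
    rw [integrable_prod_iff (by fun_prop)]
    constructor
    · refine ae_of_all _ fun x ↦ Integrable.of_integral_ne_zero ?_
      change ∫ t in Ioi (0 : ℝ), f x t ≠ 0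
      rw [hfx]
      exact (mul_pos (Real.rpow_pos_of_pos (hpos x) _) (Real.Gamma_pos_of_pos ha0)).ne'
    · have : ∀ x, ∫ t in Ioi (0 : ℝ), ‖Function.uncurry f (x, t)‖ =
          (1 + ‖x‖ ^ 2) ^ (-(2 * a) / 2) * Real.Gamma a := fun x ↦ by
        rw [show -(2 * a) / 2 = -a by ring, ← hfx]
        refine setIntegral_congr_fun measurableSet_Ioi fun t ht ↦ ?_
        have ht : 0 < t := ht
        change ‖t ^ (a - 1) * rexp (-((1 + ‖x‖ ^ 2) * t))‖ = _
        exact Real.norm_of_nonneg (by positivity)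
      simp_rw [this]
      exact (integrable_rpow_neg_one_add_norm_sq (by linarith)).mul_const _
  have key := integral_integral_swap hint
  rw [setIntegral_congr_fun measurableSet_Ioi hft] at key
  simp_rw [hfx] at key
  rw [integral_mul_const, integral_const_mul,
    Real.integral_rpow_mul_exp_neg_mul_Ioi (by linarith) one_pos] at key
  rw [eq_div_iff (Real.Gamma_pos_of_pos ha0).ne', key]
  simp

section Translation

variable {V : Type*} [NormedAddCommGroup V] [InnerProductSpace ℝ V] [FiniteDimensional ℝ V]

theorem norm_gradient (u : V → ℝ) (x : V) : ‖gradient u x‖ = ‖fderiv ℝ u x‖ := by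
  rw [gradient, LinearIsometryEquiv.norm_map]

omit [FiniteDimensional ℝ V] in
theorem norm_add_inv_smul_rpow (x e : V) {s : ℝ} (hs : 0 < s) (c : ℝ) :
    ‖x + s⁻¹ • e‖ ^ c = s ^ (-c) * ‖s • x + e‖ ^ c := by
  have : x + s⁻¹ • e = s⁻¹ • (s • x + e) := by
    rw [smul_add, smul_smul, inv_mul_cancel₀ hs.ne', one_smul]
  rw [this, norm_smul, Real.norm_of_nonneg (by positivity),
    Real.mul_rpow (by positivity) (norm_nonneg _), Real.inv_rpow hs.le, Real.rpow_neg hs.le]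

variable [MeasurableSpace V] [BorelSpace V]

theorem continuous_integral_norm_rpow_mul {g : V → ℝ} (hg : Continuous g)
    (hgs : HasCompactSupport g) (e : V) {c : ℝ} (hc : 0 ≤ c) :
    Continuous fun s : ℝ ↦ ∫ x, ‖s • x + e‖ ^ c * g x := by
  have h := continuous_parametric_integral_of_continuous (μ := (volume : Measure V))
    (f := fun (s : ℝ) x ↦ ‖s • x + e‖ ^ c * g x) (s := tsupport g)
    (((by fun_prop : Continuous fun p : ℝ × V ↦ ‖p.1 • p.2 + e‖).rpow_const
      fun _ ↦ Or.inr hc).mul (hg.comp continuous_snd)) hgs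
  convert h using 2 with s
  refine (setIntegral_eq_integral_of_forall_compl_eq_zero fun x hx ↦ ?_).symm
  rw [image_eq_zero_of_notMem_tsupport hx, mul_zero]

/-- A compactly supported function violating an unweighted gradient inequality can be moved far
from the origin, where it violates the inequality with homogeneous weights. -/
theorem exists_weighted_of_unweighted [Nontrivial V] {φ : V → ℝ} (hφ : ContDiff ℝ (⊤ : ℕ∞) φ)
    (hφs : HasCompactSupport φ) {C q r c : ℝ} (hq : 0 < q) (hr : 0 < r) (hc : 0 ≤ c)
    (h : ∫ x, ‖fderiv ℝ φ x‖ ^ 2 < C * (∫ x, |φ x| ^ q) ^ r) :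
    ∃ u : V → ℝ, u ≠ 0 ∧ ContDiff ℝ (⊤ : ℕ∞) u ∧ HasCompactSupport u ∧
      ∫ x, ‖x‖ ^ c * ‖gradient u x‖ ^ 2 < C * (∫ x, ‖x‖ ^ (c / r) * |u x| ^ q) ^ r := by
  obtain ⟨e, he⟩ := exists_norm_eq V zero_le_one
  have hF := continuous_integral_norm_rpow_mul (g := fun x ↦ ‖fderiv ℝ φ x‖ ^ 2)
    ((hφ.continuous_fderiv (by simp)).norm.pow 2)
    (hφs.fderiv (𝕜 := ℝ) |>.comp_left (g := fun L ↦ ‖L‖ ^ 2) (by simp)) e hc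
  have hH := continuous_integral_norm_rpow_mul (g := fun x ↦ |φ x| ^ q)
    (hφ.continuous.abs.rpow_const fun _ ↦ Or.inr hq.le)
    (hφs.comp_left (g := fun t ↦ |t| ^ q) (by simp [hq.ne'])) e (c := c / r) (by positivity)
  have hlt : ∀ᶠ s in 𝓝[>] (0 : ℝ), ∫ x, ‖s • x + e‖ ^ c * ‖fderiv ℝ φ x‖ ^ 2 <
      C * (∫ x, ‖s • x + e‖ ^ (c / r) * |φ x| ^ q) ^ r := by
    refine nhdsWithin_le_nhds ?_
    refine hF.continuousAt.eventually_lt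
      (continuousAt_const.mul (hH.continuousAt.rpow_const (Or.inr hr.le))) ?_
    simpa [he] using h
  obtain ⟨s, hs, hs0⟩ := (hlt.and self_mem_nhdsWithin).exists
  have hs0 : 0 < s := hs0
  have hmain : ∫ x, ‖x‖ ^ c * ‖gradient (fun x ↦ φ (x - s⁻¹ • e)) x‖ ^ 2 <
      C * (∫ x, ‖x‖ ^ (c / r) * |φ (x - s⁻¹ • e)| ^ q) ^ r := by
    have h1 : ∫ x, ‖x‖ ^ c * ‖gradient (fun x ↦ φ (x - s⁻¹ • e)) x‖ ^ 2 =
        s ^ (-c) * ∫ x, ‖s • x + e‖ ^ c * ‖fderiv ℝ φ x‖ ^ 2 := by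
      rw [← integral_const_mul, ← integral_add_right_eq_self _ (s⁻¹ • e)]
      simp_rw [norm_gradient, fderiv_comp_sub, add_sub_cancel_right,
        norm_add_inv_smul_rpow _ _ hs0, mul_assoc]
    have h2 : ∫ x, ‖x‖ ^ (c / r) * |φ (x - s⁻¹ • e)| ^ q =
        s ^ (-(c / r)) * ∫ x, ‖s • x + e‖ ^ (c / r) * |φ x| ^ q := by
      rw [← integral_const_mul, ← integral_add_right_eq_self _ (s⁻¹ • e)]
      simp_rw [add_sub_cancel_right, norm_add_inv_smul_rpow _ _ hs0, mul_assoc]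
    have h3 : (s ^ (-(c / r))) ^ r = s ^ (-c) := by
      rw [← Real.rpow_mul hs0.le]
      congr 1
      field_simp
    rw [h1, h2, Real.mul_rpow (by positivity) (integral_nonneg fun x ↦ by positivity), h3,
      mul_left_comm]
    exact mul_lt_mul_of_pos_left hs (by positivity)
  refine ⟨fun x ↦ φ (x - s⁻¹ • e), fun h0 ↦ ?_, by fun_prop, ?_, hmain⟩
  · rw [h0] at hmain
    have h0' : ∀ x, φ (x - s⁻¹ • e) = 0 := fun x ↦ congrFun h0 x
    have hg : ∀ x, gradient (0 : V → ℝ) x = 0 := fun x ↦ gradient_fun_const (c := (0 : ℝ)) x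
    simp [h0', hg, Real.zero_rpow hq.ne', Real.zero_rpow hr.ne'] at hmain
  · exact hφs.comp_homeomorph (Homeomorph.subRight (s⁻¹ • e))

end Translation

section Truncation

variable {V : Type*} [NormedAddCommGroup V] [InnerProductSpace ℝ V] [FiniteDimensional ℝ V]
  [MeasurableSpace V] [BorelSpace V]

theorem exists_bound_deriv_mul_smoothTransition :
    ∃ M, ∀ t, |deriv (fun t ↦ t * smoothTransition (t - 1)) t| ≤ M := by
  set G : ℝ → ℝ := fun t ↦ t * smoothTransition (t - 1) with hG
  have hsmooth : ContDiff ℝ 1 G :=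
    contDiff_id.mul (smoothTransition.contDiff.comp (contDiff_id.sub contDiff_const))
  obtain ⟨M, hM⟩ := (isCompact_Icc (a := (1 : ℝ)) (b := 2)).exists_bound_of_continuousOn
    (hsmooth.continuous_deriv le_rfl).continuousOn
  refine ⟨max M 1, fun t ↦ ?_⟩
  rcases lt_or_ge t 1 with h | h
  · have : G =ᶠ[𝓝 t] fun _ ↦ 0 := by
      filter_upwards [Iio_mem_nhds h] with y hy
      have hy : y < 1 := hy
      simp [hG, smoothTransition.zero_of_nonpos (sub_nonpos.2 hy.le)]
    simp [this.deriv_eq]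
  rcases le_or_gt t 2 with h2 | h2
  · exact (hM t ⟨h, h2⟩).trans (le_max_left _ _)
  · have : G =ᶠ[𝓝 t] id := by
      filter_upwards [Ioi_mem_nhds h2] with y hy
      have hy : 2 < y := hy
      simp [hG, smoothTransition.one_of_one_le (by linarith : 1 ≤ y - 1)]
    simp [this.deriv_eq]

/-- A positive smooth function vanishing at infinity that violates a gradient inequality has a
compactly supported truncation that also violates it. -/
theorem exists_compactSupport_of_tendsto_zero {U : V → ℝ} (hU : ContDiff ℝ (⊤ : ℕ∞) U)
    (hpos : ∀ x, 0 < U x) (hU0 : Tendsto U (cocompact V) (𝓝 0)) {C q r : ℝ} (hq : 0 < q)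
    (hr : 0 < r) (hint : Integrable fun x ↦ ‖fderiv ℝ U x‖ ^ 2) (hint' : Integrable fun x ↦ U x ^ q)
    (h : ∫ x, ‖fderiv ℝ U x‖ ^ 2 < C * (∫ x, U x ^ q) ^ r) :
    ∃ φ : V → ℝ, ContDiff ℝ (⊤ : ℕ∞) φ ∧ HasCompactSupport φ ∧
      ∫ x, ‖fderiv ℝ φ x‖ ^ 2 < C * (∫ x, |φ x| ^ q) ^ r := by
  obtain ⟨M, hM⟩ := exists_bound_deriv_mul_smoothTransition
  set G : ℝ → ℝ := fun t ↦ t * smoothTransition (t - 1) with hG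
  have hGsmooth : ContDiff ℝ (⊤ : ℕ∞) G :=
    contDiff_id.mul (smoothTransition.contDiff.comp (contDiff_id.sub contDiff_const))
  let φ : ℕ → V → ℝ := fun k x ↦ U x * smoothTransition (k * U x - 1)
  have hφ : ∀ k, ContDiff ℝ (⊤ : ℕ∞) (φ k) := fun k ↦
    hU.mul (smoothTransition.contDiff.comp ((contDiff_const.mul hU).sub contDiff_const))
  have hφs : ∀ k, HasCompactSupport (φ k) := fun k ↦ by
    rw [hasCompactSupport_iff_eventuallyEq, coclosedCompact_eq_cocompact]
    have : ∀ᶠ x in cocompact V, (k : ℝ) * U x < 1 :=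
      (hU0.const_mul (k : ℝ)).eventually_lt_const (by simp)
    filter_upwards [this] with x hx
    simp [φ, smoothTransition.zero_of_nonpos (sub_nonpos.2 hx.le)]
  have hlarge : ∀ x, ∀ᶠ k : ℕ in atTop, 2 < k * U x := fun x ↦
    (tendsto_natCast_atTop_atTop.atTop_mul_const (hpos x)).eventually_gt_atTop 2
  have hφU : ∀ x (k : ℕ), 2 < k * U x → φ k =ᶠ[𝓝 x] U := fun x k hk ↦ by
    filter_upwards [(continuous_const.mul hU.continuous).continuousAt.eventually_const_lt hk]
      with y hy
    have hy : 2 < k * U y := hy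
    simp [φ, smoothTransition.one_of_one_le (by linarith : 1 ≤ k * U y - 1)]
  have hbound : ∀ k ≥ 1, ∀ x, ‖fderiv ℝ (φ k) x‖ ≤ M * ‖fderiv ℝ U x‖ := fun k hk x ↦ by
    have hk0 : (k : ℝ) ≠ 0 := by positivity
    have hφG : φ k = fun x ↦ (k : ℝ)⁻¹ * G (k * U x) := by
      ext y
      simp only [φ, hG]
      field_simp
    have hUd := (hU.differentiable (by simp) x).hasFDerivAt
    have hGd := (hGsmooth.differentiable (by simp) (k * U x)).hasDerivAt
    have hd := (hGd.comp_hasFDerivAt x (hUd.const_mul (k : ℝ))).const_mul (k : ℝ)⁻¹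
    have hd' : fderiv ℝ (φ k) x = deriv G (k * U x) • fderiv ℝ U x := by
      rw [hφG]
      refine hd.fderiv.trans ?_
      rw [smul_smul, smul_smul]
      congr 1
      field_simp
    rw [hd', norm_smul, Real.norm_eq_abs]
    gcongr
    exact hM _
  have hgrad : Tendsto (fun k ↦ ∫ x, ‖fderiv ℝ (φ k) x‖ ^ 2) atTop
      (𝓝 (∫ x, ‖fderiv ℝ U x‖ ^ 2)) := by
    refine tendsto_integral_filter_of_dominated_convergence
      (fun x ↦ M ^ 2 * ‖fderiv ℝ U x‖ ^ 2) ?_ ?_ (hint.const_mul _) ?_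
    · exact Eventually.of_forall fun k ↦
        (((hφ k).continuous_fderiv (by simp)).norm.pow 2).aestronglyMeasurable
    · filter_upwards [eventually_ge_atTop 1] with k hk
      refine ae_of_all _ fun x ↦ ?_
      rw [Real.norm_of_nonneg (by positivity), ← mul_pow]
      gcongr
      exact hbound k hk x
    · refine ae_of_all _ fun x ↦ tendsto_const_nhds.congr' ?_
      filter_upwards [hlarge x] with k hk
      rw [(hφU x k hk).fderiv_eq]
  have hpow : Tendsto (fun k ↦ ∫ x, |φ k x| ^ q) atTop (𝓝 (∫ x, U x ^ q)) := by
    refine tendsto_integral_filter_of_dominated_convergence (fun x ↦ U x ^ q) ?_ ?_ hint' ?_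
    · exact Eventually.of_forall fun k ↦
        ((hφ k).continuous.abs.rpow_const fun _ ↦ Or.inr hq.le).aestronglyMeasurable
    · refine Eventually.of_forall fun k ↦ ae_of_all _ fun x ↦ ?_
      rw [Real.norm_of_nonneg (by positivity)]
      gcongr
      rw [abs_of_nonneg (mul_nonneg (hpos x).le (smoothTransition.nonneg _))]
      exact mul_le_of_le_one_right (hpos x).le (smoothTransition.le_one _)
    · refine ae_of_all _ fun x ↦ tendsto_const_nhds.congr' ?_
      filter_upwards [hlarge x] with k hk
      rw [(hφU x k hk).eq_of_nhds, abs_of_pos (hpos x)]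
  obtain ⟨k, hk⟩ :=
    (hgrad.eventually_lt ((hpow.rpow_const (Or.inr hr.le)).const_mul C) h).exists
  exact ⟨φ k, hφ k, hφs k, hk⟩

end Truncation

section Extremal

variable {V : Type*} [NormedAddCommGroup V] [InnerProductSpace ℝ V]

theorem contDiff_one_add_norm_sq_rpow (p : ℝ) :
    ContDiff ℝ (⊤ : ℕ∞) fun x : V ↦ (1 + ‖x‖ ^ 2) ^ p :=
  (contDiff_const.add (contDiff_norm_sq ℝ)).rpow_const_of_ne fun x ↦ by positivity

theorem norm_fderiv_one_add_norm_sq_rpow_sq (p : ℝ) (x : V) :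
    ‖fderiv ℝ (fun x : V ↦ (1 + ‖x‖ ^ 2) ^ p) x‖ ^ 2 =
      4 * p ^ 2 * ((1 + ‖x‖ ^ 2) ^ (2 * p - 1) - (1 + ‖x‖ ^ 2) ^ (2 * p - 2)) := by
  have h0 : 0 < 1 + ‖x‖ ^ 2 := by positivity
  have hd := ((hasStrictFDerivAt_norm_sq x).hasFDerivAt.const_add 1).rpow_const (p := p)
    (Or.inl h0.ne')
  have h1 : (1 + ‖x‖ ^ 2) ^ (2 * p - 2) = ((1 + ‖x‖ ^ 2) ^ (p - 1)) ^ 2 := by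
    rw [← Real.rpow_natCast (_ ^ (p - 1)), ← Real.rpow_mul h0.le]
    congr 1
    push_cast
    ring
  have h2 : (1 + ‖x‖ ^ 2) ^ (2 * p - 1) = (1 + ‖x‖ ^ 2) * (1 + ‖x‖ ^ 2) ^ (2 * p - 2) := by
    rw [mul_comm (1 + ‖x‖ ^ 2), ← Real.rpow_add_one h0.ne']
    congr 1
    ring
  rw [hd.fderiv, h2, h1, norm_smul, ← Nat.cast_smul_eq_nsmul ℝ, norm_smul, innerSL_apply_norm,
    mul_pow, Real.norm_eq_abs, sq_abs]
  simp
  ring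

theorem tendsto_one_add_norm_sq_rpow_cocompact [FiniteDimensional ℝ V] {p : ℝ} (hp : 0 < p) :
    Tendsto (fun x : V ↦ (1 + ‖x‖ ^ 2) ^ (-p)) (cocompact V) (𝓝 0) :=
  (tendsto_rpow_neg_atTop hp).comp (tendsto_atTop_add_const_left _ _
    ((tendsto_pow_atTop two_ne_zero).comp tendsto_norm_cocompact_atTop))

end Extremal

theorem integrable_one_add_norm_sq_rpow_neg {V : Type*} [NormedAddCommGroup V]
    [InnerProductSpace ℝ V] [FiniteDimensional ℝ V] [MeasurableSpace V] [BorelSpace V]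
    {a : ℝ} (ha : (Module.finrank ℝ V : ℝ) / 2 < a) :
    Integrable fun x : V ↦ (1 + ‖x‖ ^ 2) ^ (-a) := by
  have := integrable_rpow_neg_one_add_norm_sq (E := V) (μ := volume) (r := 2 * a) (by linarith)
  simpa [neg_div] using this

/-- The Dirichlet energy of the Aubin–Talenti function attains the Sobolev constant. -/
theorem sobolevConst_mul_rpow_eq {n : ℕ} (hn : 3 ≤ n) :
    ((n : ℝ) - 2) ^ 2 *
        (π ^ (n / 2 : ℝ) * Real.Gamma ((n : ℝ) - 1 - n / 2) / Real.Gamma ((n : ℝ) - 1) -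
          π ^ (n / 2 : ℝ) * Real.Gamma ((n : ℝ) - n / 2) / Real.Gamma n) =
      sobolevConst n *
        (π ^ (n / 2 : ℝ) * Real.Gamma ((n : ℝ) - n / 2) / Real.Gamma n) ^
          (((n : ℝ) - 2) / n) := by
  have hn' : (3 : ℝ) ≤ n := by exact_mod_cast hn
  have hn0 : (n : ℝ) ≠ 0 := by positivity
  have hg1 : Real.Gamma ((n : ℝ) / 2) = (n / 2 - 1) * Real.Gamma (n / 2 - 1) := by
    rw [← Real.Gamma_add_one (by linarith)]
    ring_nf
  have hg2 : Real.Gamma (n : ℝ) = (n - 1) * Real.Gamma ((n : ℝ) - 1) := by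
    rw [← Real.Gamma_add_one (by linarith)]
    ring_nf
  have hG : 0 < Real.Gamma ((n : ℝ) / 2) / Real.Gamma (n : ℝ) :=
    div_pos (Real.Gamma_pos_of_pos (by linarith)) (Real.Gamma_pos_of_pos (by linarith))
  have hI : 0 < π ^ (n / 2 : ℝ) * (Real.Gamma ((n : ℝ) / 2) / Real.Gamma (n : ℝ)) := by positivity
  have hpow : π * (Real.Gamma ((n : ℝ) / 2) / Real.Gamma (n : ℝ)) ^ (2 / (n : ℝ)) =
      (π ^ (n / 2 : ℝ) * (Real.Gamma ((n : ℝ) / 2) / Real.Gamma (n : ℝ))) ^ (2 / (n : ℝ)) := by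
    rw [Real.mul_rpow (by positivity) hG.le, ← Real.rpow_mul pi_pos.le]
    field_simp
    simp
  have hsub : (n : ℝ) - n / 2 = n / 2 := by ring
  have hsub' : (n : ℝ) - 1 - n / 2 = n / 2 - 1 := by ring
  have hS : sobolevConst n = n * (n - 2) *
      (π ^ (n / 2 : ℝ) * (Real.Gamma ((n : ℝ) / 2) / Real.Gamma (n : ℝ))) ^ (2 / (n : ℝ)) := by
    rw [← hpow, sobolevConst]
    ring
  rw [hS, hsub, hsub', mul_div_assoc _ (Real.Gamma ((n : ℝ) / 2)), mul_assoc,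
    ← Real.rpow_add hI, show 2 / (n : ℝ) + (n - 2) / n = 1 by field_simp; ring, Real.rpow_one,
    hg1, hg2]
  have h1 : (n : ℝ) - 1 ≠ 0 := by linarith
  have h2 : Real.Gamma ((n : ℝ) - 1) ≠ 0 := (Real.Gamma_pos_of_pos (by linarith)).ne'
  field_simp
  ring

theorem stmt17 (n : ℕ) (hn : 3 ≤ n) (b : ℝ) (hb : 0 < b)
    (C : ℝ) (hC : C > sobolevConst n) :
    ∃ u : EuclideanSpace ℝ (Fin n) → ℝ, u ≠ 0 ∧ ContDiff ℝ (⊤ : ℕ∞) u ∧ HasCompactSupport u ∧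
      (∫ x : EuclideanSpace ℝ (Fin n), ‖x‖ ^ (2 * b) * ‖gradient u x‖ ^ 2)
        < C *
          (∫ x : EuclideanSpace ℝ (Fin n),
              ‖x‖ ^ (2 * b * (n : ℝ) / ((n : ℝ) - 2)) *
                |u x| ^ (2 * (n : ℝ) / ((n : ℝ) - 2)))
            ^ (((n : ℝ) - 2) / (n : ℝ)) := by

  have hn' : (3 : ℝ) ≤ n := by exact_mod_cast hn
  have : Nontrivial (EuclideanSpace ℝ (Fin n)) :=
    Module.nontrivial_of_finrank_pos (R := ℝ) (by simp; omega)
  have hfin : (Module.finrank ℝ (EuclideanSpace ℝ (Fin n)) : ℝ) = n := by simp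
  have hp0 : 0 < ((n : ℝ) - 2) / 2 := by linarith
  have hq : 0 < 2 * (n : ℝ) / (n - 2) := div_pos (by linarith) (by linarith)
  have hr : 0 < ((n : ℝ) - 2) / n := div_pos (by linarith) (by linarith)
  let U : EuclideanSpace ℝ (Fin n) → ℝ := fun x ↦ (1 + ‖x‖ ^ 2) ^ (-(((n : ℝ) - 2) / 2))
  have hgrad : ∀ x, ‖fderiv ℝ U x‖ ^ 2 = ((n : ℝ) - 2) ^ 2 *
      ((1 + ‖x‖ ^ 2) ^ (-((n : ℝ) - 1)) - (1 + ‖x‖ ^ 2) ^ (-(n : ℝ))) := fun x ↦ by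
    rw [norm_fderiv_one_add_norm_sq_rpow_sq]
    ring_nf
  have hpow : ∀ x, U x ^ (2 * (n : ℝ) / (n - 2)) = (1 + ‖x‖ ^ 2) ^ (-(n : ℝ)) := fun x ↦ by
    have : (n : ℝ) - 2 ≠ 0 := by linarith
    rw [← Real.rpow_mul (by positivity)]
    congr 1
    field_simp
  have hn1 : (Module.finrank ℝ (EuclideanSpace ℝ (Fin n)) : ℝ) / 2 < n - 1 := by
    rw [hfin]; linarith
  have hn2 : (Module.finrank ℝ (EuclideanSpace ℝ (Fin n)) : ℝ) / 2 < n := by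
    rw [hfin]; linarith
  have hint1 := integrable_one_add_norm_sq_rpow_neg hn1
  have hint2 := integrable_one_add_norm_sq_rpow_neg hn2
  obtain ⟨φ, hφ, hφs, hφlt⟩ := exists_compactSupport_of_tendsto_zero (U := U) (C := C)
    (contDiff_one_add_norm_sq_rpow _) (fun x ↦ by positivity)
    (tendsto_one_add_norm_sq_rpow_cocompact hp0) hq hr
    (by simp_rw [hgrad]; exact (hint1.sub hint2).const_mul _) (by simpa only [hpow] using hint2) (by
      simp_rw [hgrad, hpow]
      rw [integral_const_mul, integral_sub hint1 hint2, integral_one_add_norm_sq_rpow_neg_s17 hn1,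
        integral_one_add_norm_sq_rpow_neg_s17 hn2, hfin, sobolevConst_mul_rpow_eq hn]
      refine mul_lt_mul_of_pos_right hC (Real.rpow_pos_of_pos (div_pos (mul_pos (by positivity)
        (Real.Gamma_pos_of_pos ?_)) (Real.Gamma_pos_of_pos ?_)) _) <;> linarith)
  have hexp : 2 * b / (((n : ℝ) - 2) / n) = 2 * b * n / (n - 2) := by
    rw [div_div_eq_mul_div]
  simpa only [hexp] using
    exists_weighted_of_unweighted hφ hφs (c := 2 * b) hq hr (by positivity) hφlt
end
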